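/- Let W be a bi-regular multiplicative unitary on a complex Hilbert space H and Ŵ := ΣW*Σ. Set D := A(Ŵ) ⊗min A(W) ⊆ B(H ⊗ H). Then W is a multiplier of D (W·x ∈ D and x·W ∈ D for all x ∈ D), and [(a ⊗ 1)·W·(1 ⊗ b) : a ∈ A(Ŵ), b ∈ A(W)] = A(Ŵ) ⊗min A(W). -/

import Mathlib

/-!
Common framework: we axiomatize realizations of Hilbert-space tensor products.
A `TensorPair E F EF` realizes the Hilbert tensor product `E ⊗ F` as the Hilbert
space `EF`: it consists of a bilinear map `(a, b) ↦ a ⊗ b` whose image satisfies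
the characteristic inner-product identity and has total (dense) linear span.
Operators such as the leg operators `X₁₂`, `X₂₃`, `X₁₃`, amplifications `a ⊗ b`,
and the tensor flip `Σ` are then uniquely characterized by their matrix
coefficients against elementary tensors.
-/

noncomputable section

open scoped InnerProductSpace
open ContinuousLinearMap

/-- A realization of the Hilbert tensor product `E ⊗ F` as the Hilbert space `EF`. -/
structure TensorPair (E F EF : Type*)
    [NormedAddCommGroup E] [InnerProductSpace ℂ E]
    [NormedAddCommGroup F] [InnerProductSpace ℂ F]
    [NormedAddCommGroup EF] [InnerProductSpace ℂ EF] where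
  tmul : E →ₗ[ℂ] F →ₗ[ℂ] EF
  inner_tmul : ∀ (a c : E) (b d : F), ⟪tmul a b, tmul c d⟫_ℂ = ⟪a, c⟫_ℂ * ⟪b, d⟫_ℂ
  dense_span : Dense (Submodule.span ℂ {z : EF | ∃ a b, z = tmul a b} : Set EF)

/-- A realization of the threefold Hilbert tensor product `E ⊗ F ⊗ G` as `EFG`. -/
structure TensorTriple (E F G EFG : Type*)
    [NormedAddCommGroup E] [InnerProductSpace ℂ E]
    [NormedAddCommGroup F] [InnerProductSpace ℂ F]
    [NormedAddCommGroup G] [InnerProductSpace ℂ G]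
    [NormedAddCommGroup EFG] [InnerProductSpace ℂ EFG] where
  tmul : E →ₗ[ℂ] F →ₗ[ℂ] G →ₗ[ℂ] EFG
  inner_tmul : ∀ (a a' : E) (b b' : F) (c c' : G),
    ⟪tmul a b c, tmul a' b' c'⟫_ℂ = ⟪a, a'⟫_ℂ * ⟪b, b'⟫_ℂ * ⟪c, c'⟫_ℂ
  dense_span : Dense (Submodule.span ℂ {z : EFG | ∃ a b c, z = tmul a b c} : Set EFG)

/-- The norm-closed linear span `[S]` of a set of vectors/operators. -/
def cspan {V : Type*} [NormedAddCommGroup V] [NormedSpace ℂ V] (S : Set V) : Set V :=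
  closure (Submodule.span ℂ S : Set V)

/-- The set of right-leg slices `(id ⊗ ω_{ξ,η})(X)` of an operator
`X : M₁ ⊗ K₁ → M₂ ⊗ K₂`, i.e. all operators `T : M₁ → M₂` such that
`⟪ζ, T ζ'⟫ = ⟪ζ ⊗ ξ, X (ζ' ⊗ η)⟫` for some `ξ ∈ K₂`, `η ∈ K₁`. -/
def slicesR {M₁ K₁ M₂ K₂ Ha Hb : Type*}
    [NormedAddCommGroup M₁] [InnerProductSpace ℂ M₁]
    [NormedAddCommGroup K₁] [InnerProductSpace ℂ K₁]
    [NormedAddCommGroup M₂] [InnerProductSpace ℂ M₂]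
    [NormedAddCommGroup K₂] [InnerProductSpace ℂ K₂]
    [NormedAddCommGroup Ha] [InnerProductSpace ℂ Ha]
    [NormedAddCommGroup Hb] [InnerProductSpace ℂ Hb]
    (ta : TensorPair M₁ K₁ Ha) (tb : TensorPair M₂ K₂ Hb)
    (X : Ha →L[ℂ] Hb) : Set (M₁ →L[ℂ] M₂) :=
  {T | ∃ (ξ : K₂) (η : K₁), ∀ (ζ : M₂) (ζ' : M₁),
    ⟪ζ, T ζ'⟫_ℂ = ⟪tb.tmul ζ ξ, X (ta.tmul ζ' η)⟫_ℂ}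

/-- The set of left-leg slices `(ω_{ξ,η} ⊗ id)(X)` of an operator
`X : K₁ ⊗ M₁ → K₂ ⊗ M₂`, i.e. all operators `T : M₁ → M₂` such that
`⟪ζ, T ζ'⟫ = ⟪ξ ⊗ ζ, X (η ⊗ ζ')⟫` for some `ξ ∈ K₂`, `η ∈ K₁`. -/
def slicesL {M₁ K₁ M₂ K₂ Ha Hb : Type*}
    [NormedAddCommGroup M₁] [InnerProductSpace ℂ M₁]
    [NormedAddCommGroup K₁] [InnerProductSpace ℂ K₁]
    [NormedAddCommGroup M₂] [InnerProductSpace ℂ M₂]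
    [NormedAddCommGroup K₂] [InnerProductSpace ℂ K₂]
    [NormedAddCommGroup Ha] [InnerProductSpace ℂ Ha]
    [NormedAddCommGroup Hb] [InnerProductSpace ℂ Hb]
    (ta : TensorPair K₁ M₁ Ha) (tb : TensorPair K₂ M₂ Hb)
    (X : Ha →L[ℂ] Hb) : Set (M₁ →L[ℂ] M₂) :=
  {T | ∃ (ξ : K₂) (η : K₁), ∀ (ζ : M₂) (ζ' : M₁),
    ⟪ζ, T ζ'⟫_ℂ = ⟪tb.tmul ξ ζ, X (ta.tmul η ζ')⟫_ℂ}

/-- `Â(X) := [(id ⊗ ω_{ξ,η})(X) : ξ, η ∈ H] ⊆ B(H)` for `X ∈ B(H ⊗ H)`. -/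
def hatA {H H2 : Type*}
    [NormedAddCommGroup H] [InnerProductSpace ℂ H]
    [NormedAddCommGroup H2] [InnerProductSpace ℂ H2]
    (t2 : TensorPair H H H2) (X : H2 →L[ℂ] H2) : Set (H →L[ℂ] H) :=
  cspan (slicesR t2 t2 X)

/-- `A(X) := [(ω_{ξ,η} ⊗ id)(X) : ξ, η ∈ H] ⊆ B(H)` for `X ∈ B(H ⊗ H)`. -/
def legA {H H2 : Type*}
    [NormedAddCommGroup H] [InnerProductSpace ℂ H]
    [NormedAddCommGroup H2] [InnerProductSpace ℂ H2]
    (t2 : TensorPair H H H2) (X : H2 →L[ℂ] H2) : Set (H →L[ℂ] H) :=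
  cspan (slicesL t2 t2 X)

/-- `T` is the tensor-product operator `a ⊗ b : E ⊗ F → E' ⊗ F'`, characterized by its
matrix coefficients against elementary tensors.  In particular `IsTensorOp ta tb a 1 T`
says that `T = a ⊗ 1`, and `IsTensorOp ta tb 1 b T` that `T = 1 ⊗ b`. -/
def IsTensorOp {E F EF E' F' EF' : Type*}
    [NormedAddCommGroup E] [InnerProductSpace ℂ E]
    [NormedAddCommGroup F] [InnerProductSpace ℂ F]
    [NormedAddCommGroup EF] [InnerProductSpace ℂ EF]
    [NormedAddCommGroup E'] [InnerProductSpace ℂ E']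
    [NormedAddCommGroup F'] [InnerProductSpace ℂ F']
    [NormedAddCommGroup EF'] [InnerProductSpace ℂ EF']
    (ta : TensorPair E F EF) (tb : TensorPair E' F' EF')
    (a : E →L[ℂ] E') (b : F →L[ℂ] F') (T : EF →L[ℂ] EF') : Prop :=
  ∀ (ζ : E') (ξ : F') (ζ' : E) (η : F),
    ⟪tb.tmul ζ ξ, T (ta.tmul ζ' η)⟫_ℂ = ⟪ζ, a ζ'⟫_ℂ * ⟪ξ, b η⟫_ℂ

/-- `A ⊗min B := [(a ⊗ 1)(1 ⊗ b) : a ∈ A, b ∈ B] = [a ⊗ b : a ∈ A, b ∈ B]`. -/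
def minTensor {E F EF : Type*}
    [NormedAddCommGroup E] [InnerProductSpace ℂ E]
    [NormedAddCommGroup F] [InnerProductSpace ℂ F]
    [NormedAddCommGroup EF] [InnerProductSpace ℂ EF]
    (t : TensorPair E F EF)
    (A : Set (E →L[ℂ] E)) (B : Set (F →L[ℂ] F)) : Set (EF →L[ℂ] EF) :=
  cspan {T | ∃ a ∈ A, ∃ b ∈ B, IsTensorOp t t a b T}

/-- `Y = X₁₂ = X ⊗ 1` on `E ⊗ F ⊗ G`, for `X ∈ B(E ⊗ F)`. -/
def IsLeg12 {E F G EF EFG : Type*}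
    [NormedAddCommGroup E] [InnerProductSpace ℂ E]
    [NormedAddCommGroup F] [InnerProductSpace ℂ F]
    [NormedAddCommGroup G] [InnerProductSpace ℂ G]
    [NormedAddCommGroup EF] [InnerProductSpace ℂ EF]
    [NormedAddCommGroup EFG] [InnerProductSpace ℂ EFG]
    (t2 : TensorPair E F EF) (t3 : TensorTriple E F G EFG)
    (X : EF →L[ℂ] EF) (Y : EFG →L[ℂ] EFG) : Prop :=
  ∀ (a a' : E) (b b' : F) (c c' : G),
    ⟪t3.tmul a b c, Y (t3.tmul a' b' c')⟫_ℂ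
      = ⟪t2.tmul a b, X (t2.tmul a' b')⟫_ℂ * ⟪c, c'⟫_ℂ

/-- `Y = X₂₃ = 1 ⊗ X` on `E ⊗ F ⊗ G`, for `X ∈ B(F ⊗ G)`. -/
def IsLeg23 {E F G FG EFG : Type*}
    [NormedAddCommGroup E] [InnerProductSpace ℂ E]
    [NormedAddCommGroup F] [InnerProductSpace ℂ F]
    [NormedAddCommGroup G] [InnerProductSpace ℂ G]
    [NormedAddCommGroup FG] [InnerProductSpace ℂ FG]
    [NormedAddCommGroup EFG] [InnerProductSpace ℂ EFG]
    (t2 : TensorPair F G FG) (t3 : TensorTriple E F G EFG)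
    (X : FG →L[ℂ] FG) (Y : EFG →L[ℂ] EFG) : Prop :=
  ∀ (a a' : E) (b b' : F) (c c' : G),
    ⟪t3.tmul a b c, Y (t3.tmul a' b' c')⟫_ℂ
      = ⟪t2.tmul b c, X (t2.tmul b' c')⟫_ℂ * ⟪a, a'⟫_ℂ

/-- `Y = X₁₃ = Σ₁₂X₂₃Σ₁₂` on `E ⊗ F ⊗ G`, for `X ∈ B(E ⊗ G)`: `X` acting on the
first and third legs. -/
def IsLeg13 {E F G EG EFG : Type*}
    [NormedAddCommGroup E] [InnerProductSpace ℂ E]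
    [NormedAddCommGroup F] [InnerProductSpace ℂ F]
    [NormedAddCommGroup G] [InnerProductSpace ℂ G]
    [NormedAddCommGroup EG] [InnerProductSpace ℂ EG]
    [NormedAddCommGroup EFG] [InnerProductSpace ℂ EFG]
    (t2 : TensorPair E G EG) (t3 : TensorTriple E F G EFG)
    (X : EG →L[ℂ] EG) (Y : EFG →L[ℂ] EFG) : Prop :=
  ∀ (a a' : E) (b b' : F) (c c' : G),
    ⟪t3.tmul a b c, Y (t3.tmul a' b' c')⟫_ℂ
      = ⟪t2.tmul a c, X (t2.tmul a' c')⟫_ℂ * ⟪b, b'⟫_ℂ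

namespace TensorPair

open scoped TensorProduct

variable {E F G : Type*}
  [NormedAddCommGroup E] [InnerProductSpace ℂ E]
  [NormedAddCommGroup F] [InnerProductSpace ℂ F]
  [NormedAddCommGroup G] [InnerProductSpace ℂ G]

/-- The isometric embedding of the algebraic tensor product. -/
def emb (p : TensorPair E F G) : (E ⊗[ℂ] F) →ₗᵢ[ℂ] G :=
  (TensorProduct.lift p.tmul).isometryOfInner (by
    intro x y
    induction x using TensorProduct.induction_on with
    | zero => simp
    | add a b ha hb => simp only [map_add, inner_add_left, ha, hb]
    | tmul a b =>
      induction y using TensorProduct.induction_on with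
      | zero => simp
      | add c d hc hd => simp only [map_add, inner_add_right, hc, hd]
      | tmul c d => simp [p.inner_tmul])

@[simp] lemma emb_tmul (p : TensorPair E F G) (a : E) (b : F) :
    p.emb (a ⊗ₜ b) = p.tmul a b := by
  simp [emb]

lemma emb_dense (p : TensorPair E F G) : DenseRange p.emb := by
  have h : (Submodule.span ℂ {z : G | ∃ a b, z = p.tmul a b} : Set G) ⊆ Set.range p.emb := by
    have : Submodule.span ℂ {z : G | ∃ a b, z = p.tmul a b} ≤ LinearMap.range p.emb.toLinearMap := by
      rw [Submodule.span_le]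
      rintro _ ⟨a, b, rfl⟩
      exact ⟨a ⊗ₜ b, by simp⟩
    intro x hx
    exact this hx
  exact p.dense_span.mono h

/-- Swapping the two factors. -/
def flip (p : TensorPair E F G) : TensorPair F E G where
  tmul := p.tmul.flip
  inner_tmul := by intro a c b d; simp [p.inner_tmul, mul_comm]
  dense_span := by
    have : {z : G | ∃ a b, z = p.tmul.flip a b} = {z : G | ∃ a b, z = p.tmul a b} := by
      ext z; simp only [LinearMap.flip_apply, Set.mem_ofPred_eq]; exact exists_comm
    rw [this]; exact p.dense_span

@[simp] lemma flip_tmul (p : TensorPair E F G) (a : F) (b : E) :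
    p.flip.tmul a b = p.tmul b a := rfl

lemma ext_op {X : Type*} [NormedAddCommGroup X] [NormedSpace ℂ X]
    (p : TensorPair E F G) {f g : G →L[ℂ] X}
    (h : ∀ a b, f (p.tmul a b) = g (p.tmul a b)) : f = g := by
  apply ContinuousLinearMap.ext_on p.dense_span
  rintro _ ⟨a, b, rfl⟩
  exact h a b

lemma ext_vec (p : TensorPair E F G) {x y : G}
    (h : ∀ a b, ⟪p.tmul a b, x⟫_ℂ = ⟪p.tmul a b, y⟫_ℂ) : x = y := by
  have : innerSL ℂ x = innerSL ℂ y := by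
    apply p.ext_op
    intro a b
    simp only [innerSL_apply_apply]
    rw [← inner_conj_symm, h, inner_conj_symm]
  apply ext_inner_right ℂ
  intro v
  simpa using congrArg (fun f => f v) this

lemma norm_tmul (p : TensorPair E F G) (a : E) (b : F) : ‖p.tmul a b‖ = ‖a‖ * ‖b‖ := by
  rw [← p.emb_tmul, LinearIsometry.norm_map, TensorProduct.norm_tmul]

/-- `b ↦ a ⊗ b`. -/
def insL (p : TensorPair E F G) (a : E) : F →L[ℂ] G :=
  (p.tmul a).mkContinuous ‖a‖ (fun b => (p.norm_tmul a b).le)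

@[simp] lemma insL_apply (p : TensorPair E F G) (a : E) (b : F) : p.insL a b = p.tmul a b := rfl

section op
variable [CompleteSpace G]

/-- The operator `x ⊗ 1`. -/
def opL₀ (p : TensorPair E F G) (x : E →L[ℂ] E) : G →L[ℂ] G :=
  (p.emb.toLinearMap ∘ₗ (x.rTensor F).toLinearMap).extendOfNorm p.emb.toLinearMap

lemma opL₀_bound (p : TensorPair E F G) (x : E →L[ℂ] E) (z : E ⊗[ℂ] F) :
    ‖(p.emb.toLinearMap ∘ₗ (x.rTensor F).toLinearMap) z‖ ≤ ‖x‖ * ‖p.emb.toLinearMap z‖ := by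
  have h1 : ‖(x.rTensor F) z‖ ≤ ‖x‖ * ‖z‖ :=
    ((x.rTensor F).le_opNorm z).trans (by gcongr; exact ContinuousLinearMap.norm_rTensor_le F x)
  have h2 : ‖p.emb ((x.rTensor F) z)‖ ≤ ‖x‖ * ‖p.emb z‖ := by
    rw [p.emb.norm_map, p.emb.norm_map]; exact h1
  exact h2

@[simp] lemma opL₀_tmul (p : TensorPair E F G) (x : E →L[ℂ] E) (a : E) (b : F) :
    p.opL₀ x (p.tmul a b) = p.tmul (x a) b := by
  have := LinearMap.extendOfNorm_eq (f := p.emb.toLinearMap ∘ₗ (x.rTensor F).toLinearMap)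
    (e := p.emb.toLinearMap) p.emb_dense ⟨_, p.opL₀_bound x⟩ (a ⊗ₜ b)
  simpa [opL₀] using this

lemma norm_opL₀_le (p : TensorPair E F G) (x : E →L[ℂ] E) : ‖p.opL₀ x‖ ≤ ‖x‖ :=
  LinearMap.opNorm_extendOfNorm_le p.emb_dense (norm_nonneg _) (p.opL₀_bound x)

/-- `x ↦ x ⊗ 1` as an algebra homomorphism. -/
def opL (p : TensorPair E F G) : (E →L[ℂ] E) →ₐ[ℂ] (G →L[ℂ] G) :=
  AlgHom.ofLinearMap
    { toFun := p.opL₀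
      map_add' := by intro x y; apply p.ext_op; simp
      map_smul' := by intro x y; apply p.ext_op; simp }
    (by apply p.ext_op; simp)
    (by intro x y; apply p.ext_op; simp)

@[simp] lemma opL_tmul (p : TensorPair E F G) (x : E →L[ℂ] E) (a : E) (b : F) :
    p.opL x (p.tmul a b) = p.tmul (x a) b := p.opL₀_tmul x a b

lemma opL_cont (p : TensorPair E F G) : Continuous p.opL :=
  (p.opL.toLinearMap.mkContinuous 1
    (fun x => by rw [one_mul]; exact p.norm_opL₀_le x)).continuous

/-- `y ↦ 1 ⊗ y` as an algebra homomorphism. -/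
def opR (p : TensorPair E F G) : (F →L[ℂ] F) →ₐ[ℂ] (G →L[ℂ] G) := p.flip.opL

@[simp] lemma opR_tmul (p : TensorPair E F G) (y : F →L[ℂ] F) (a : E) (b : F) :
    p.opR y (p.tmul a b) = p.tmul a (y b) := p.flip.opL_tmul y b a

lemma opR_cont (p : TensorPair E F G) : Continuous p.opR := p.flip.opL_cont

lemma opL_opR (p : TensorPair E F G) (x : E →L[ℂ] E) (y : F →L[ℂ] F) :
    p.opL x * p.opR y = p.opR y * p.opL x := by
  apply p.ext_op; simp

lemma opL_star [CompleteSpace E] (p : TensorPair E F G) (x : E →L[ℂ] E) :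
    star (p.opL x) = p.opL (star x) := by
  apply p.ext_op
  intro a b
  apply p.ext_vec
  intro c d
  rw [ContinuousLinearMap.star_eq_adjoint, ContinuousLinearMap.adjoint_inner_right,
    p.opL_tmul, p.opL_tmul, p.inner_tmul, p.inner_tmul,
    ContinuousLinearMap.star_eq_adjoint, ContinuousLinearMap.adjoint_inner_right]

lemma opR_star [CompleteSpace F] (p : TensorPair E F G) (x : F →L[ℂ] F) :
    star (p.opR x) = p.opR (star x) := p.flip.opL_star x

lemma isTensorOp_iff (p : TensorPair E F G) (a : E →L[ℂ] E) (b : F →L[ℂ] F) (T : G →L[ℂ] G) :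
    IsTensorOp p p a b T ↔ T = p.opL a * p.opR b := by
  constructor
  · intro h
    apply p.ext_op
    intro c d
    apply p.ext_vec
    intro c' d'
    simp [h c' d' c d, p.inner_tmul]
  · rintro rfl ζ ξ ζ' η
    simp [p.inner_tmul]

end op
end TensorPair

namespace TensorTriple

open scoped TensorProduct

variable {E F G EF EFG : Type*}
  [NormedAddCommGroup E] [InnerProductSpace ℂ E]
  [NormedAddCommGroup F] [InnerProductSpace ℂ F]
  [NormedAddCommGroup G] [InnerProductSpace ℂ G]
  [NormedAddCommGroup EF] [InnerProductSpace ℂ EF]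
  [NormedAddCommGroup EFG] [InnerProductSpace ℂ EFG]

/-- Exchange the last two factors. -/
def swap23 (t : TensorTriple E F G EFG) : TensorTriple E G F EFG where
  tmul := LinearMap.mk₂ ℂ (fun a c => (t.tmul a).flip c)
    (by intros; ext; simp) (by intros; ext; simp) (by intros; ext; simp) (by intros; ext; simp)
  inner_tmul := by
    intros; simp only [LinearMap.mk₂_apply, LinearMap.flip_apply, t.inner_tmul]; ring
  dense_span := by
    convert t.dense_span using 4
    ext z
    simp only [LinearMap.mk₂_apply, LinearMap.flip_apply]
    constructor
    · rintro ⟨a, b, c, h⟩; exact ⟨a, c, b, h⟩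
    · rintro ⟨a, b, c, h⟩; exact ⟨a, c, b, h⟩

@[simp] lemma swap23_tmul (t : TensorTriple E F G EFG) (a : E) (b : F) (c : G) :
    t.swap23.tmul a c b = t.tmul a b c := rfl

/-- Exchange the first two factors. -/
def swap12 (t : TensorTriple E F G EFG) : TensorTriple F E G EFG where
  tmul := t.tmul.flip
  inner_tmul := by
    intros; simp only [LinearMap.flip_apply, t.inner_tmul]; ring
  dense_span := by
    convert t.dense_span using 4
    ext z
    simp only [LinearMap.flip_apply]
    constructor
    · rintro ⟨a, b, c, h⟩; exact ⟨b, a, c, h⟩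
    · rintro ⟨a, b, c, h⟩; exact ⟨b, a, c, h⟩

@[simp] lemma swap12_tmul (t : TensorTriple E F G EFG) (a : E) (b : F) (c : G) :
    t.swap12.tmul b a c = t.tmul a b c := rfl

lemma ext_op {X : Type*} [NormedAddCommGroup X] [NormedSpace ℂ X]
    (p : TensorTriple E F G EFG) {f g : EFG →L[ℂ] X}
    (h : ∀ a b c, f (p.tmul a b c) = g (p.tmul a b c)) : f = g := by
  apply ContinuousLinearMap.ext_on p.dense_span
  rintro _ ⟨a, b, c, rfl⟩
  exact h a b c

lemma ext_vec (p : TensorTriple E F G EFG) {x y : EFG}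
    (h : ∀ a b c, ⟪p.tmul a b c, x⟫_ℂ = ⟪p.tmul a b c, y⟫_ℂ) : x = y := by
  have : innerSL ℂ x = innerSL ℂ y := by
    apply p.ext_op
    intro a b c
    simp only [innerSL_apply_apply]
    rw [← inner_conj_symm, h, inner_conj_symm]
  apply ext_inner_right ℂ
  intro v
  simpa using congrArg (fun f => f v) this

variable [CompleteSpace EFG]

/-- `z ↦ z ⊗ c`. -/
def ins (t : TensorTriple E F G EFG) (p : TensorPair E F EF) (c : G) : EF →L[ℂ] EFG :=
  (TensorProduct.lift (t.swap23.swap12.tmul c)).extendOfNorm p.emb.toLinearMap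

lemma ins_inner₀ (t : TensorTriple E F G EFG) (c c' : G) (x y : E ⊗[ℂ] F) :
    ⟪TensorProduct.lift (t.swap23.swap12.tmul c) x,
      TensorProduct.lift (t.swap23.swap12.tmul c') y⟫_ℂ = ⟪x, y⟫_ℂ * ⟪c, c'⟫_ℂ := by
  induction x using TensorProduct.induction_on with
  | zero => simp
  | add a b ha hb => simp only [map_add, inner_add_left, ha, hb, add_mul]
  | tmul a b =>
    induction y using TensorProduct.induction_on with
    | zero => simp
    | add c d hc hd => simp only [map_add, inner_add_right, hc, hd, add_mul]
    | tmul c d => simp [t.inner_tmul]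

lemma ins_bound (t : TensorTriple E F G EFG) (p : TensorPair E F EF) (c : G) (x : E ⊗[ℂ] F) :
    ‖TensorProduct.lift (t.swap23.swap12.tmul c) x‖ ≤ ‖c‖ * ‖p.emb.toLinearMap x‖ := by
  have h : ‖TensorProduct.lift (t.swap23.swap12.tmul c) x‖ ^ 2 = (‖c‖ * ‖x‖) ^ 2 := by
    have := t.ins_inner₀ c c x x
    have hx : ⟪x, x⟫_ℂ = (‖x‖ : ℂ) ^ 2 := inner_self_eq_norm_sq_to_K x
    have hc : ⟪c, c⟫_ℂ = (‖c‖ : ℂ) ^ 2 := inner_self_eq_norm_sq_to_K c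
    have hy (v : EFG) : ⟪v, v⟫_ℂ = (‖v‖ : ℂ) ^ 2 := inner_self_eq_norm_sq_to_K v
    rw [hx, hc, hy] at this
    rw [mul_pow, mul_comm]
    exact_mod_cast this
  have h2 : ‖p.emb.toLinearMap x‖ = ‖x‖ := p.emb.norm_map x
  rw [h2]
  exact (pow_le_pow_iff_left₀ (norm_nonneg _) (by positivity) two_ne_zero).1 h.le

@[simp] lemma ins_tmul (t : TensorTriple E F G EFG) (p : TensorPair E F EF) (c : G) (a : E) (b : F) :
    t.ins p c (p.tmul a b) = t.tmul a b c := by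
  have := LinearMap.extendOfNorm_eq (f := TensorProduct.lift (t.swap23.swap12.tmul c))
    (e := p.emb.toLinearMap) p.emb_dense ⟨_, t.ins_bound p c⟩ (a ⊗ₜ b)
  simpa [ins] using this

lemma ins_inner (t : TensorTriple E F G EFG) (p : TensorPair E F EF) (c c' : G) (x y : EF) :
    ⟪t.ins p c x, t.ins p c' y⟫_ℂ = ⟪x, y⟫_ℂ * ⟪c, c'⟫_ℂ := by
  have h1 : ∀ a b, ∀ y c c', ⟪t.ins p c (p.tmul a b), t.ins p c' y⟫_ℂ
      = ⟪p.tmul a b, y⟫_ℂ * ⟪c, c'⟫_ℂ := by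
    intro a b y c c'
    have : (innerSL ℂ (t.ins p c (p.tmul a b))) ∘L t.ins p c'
        = ⟪c, c'⟫_ℂ • innerSL ℂ (p.tmul a b) := by
      apply p.ext_op
      intro e f
      simp [t.inner_tmul, p.inner_tmul, mul_comm]
    have h := congrArg (fun f => f y) this
    simpa [mul_comm] using h
  have : (innerSL ℂ (t.ins p c' y)) ∘L t.ins p c = ⟪c', c⟫_ℂ • innerSL ℂ y := by
    apply p.ext_op
    intro e f
    simp only [ContinuousLinearMap.comp_apply, innerSL_apply_apply, _root_.smul_apply]
    rw [← inner_conj_symm, h1, map_mul, inner_conj_symm, inner_conj_symm, smul_eq_mul, mul_comm]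
  have h := congrArg (fun f => f x) this
  simp only [ContinuousLinearMap.comp_apply, innerSL_apply_apply, _root_.smul_apply] at h
  rw [← inner_conj_symm, h, smul_eq_mul, map_mul, inner_conj_symm, inner_conj_symm, mul_comm]

/-- A triple tensor product as an iterated tensor product. -/
def pair (t : TensorTriple E F G EFG) (p : TensorPair E F EF) : TensorPair EF G EFG where
  tmul := LinearMap.mk₂ ℂ (fun z c => t.ins p c z)
    (by intros; simp) (by intros; simp)
    (by
      intro m c c'
      have : t.ins p (c + c') = t.ins p c + t.ins p c' := by apply p.ext_op; simp
      rw [this]; rfl)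
    (by
      intro k m c
      have : t.ins p (k • c) = k • t.ins p c := by apply p.ext_op; simp
      rw [this]; rfl)
  inner_tmul := by
    intros; simp only [LinearMap.mk₂_apply]; rw [ins_inner]
  dense_span := by
    refine t.dense_span.mono ?_
    apply Submodule.span_mono
    rintro _ ⟨a, b, c, rfl⟩
    exact ⟨p.tmul a b, c, by simp⟩

@[simp] lemma pair_tmul (t : TensorTriple E F G EFG) (p : TensorPair E F EF) (a : E) (b : F) (c : G) :
    (t.pair p).tmul (p.tmul a b) c = t.tmul a b c := by simp [pair]

end TensorTriple


section quot

variable {V V' : Type*} [NormedRing V] [NormedAlgebra ℂ V] [NormedRing V'] [NormedAlgebra ℂ V']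

lemma mul_le_tc {X X' Y Y' : Submodule ℂ V} (hX : X ≤ X'.topologicalClosure)
    (hY : Y ≤ Y'.topologicalClosure) : X * Y ≤ (X' * Y').topologicalClosure := by
  rw [Submodule.mul_le]
  intro m hm n hn
  have h1 : m ∈ closure (X' : Set V) := hX hm
  have h2 : n ∈ closure (Y' : Set V) := hY hn
  exact map_mem_closure₂ continuous_mul h1 h2 (fun a ha b hb => Submodule.mul_mem_mul ha hb)

lemma tc_le_iff {X Y : Submodule ℂ V} :
    X.topologicalClosure ≤ Y.topologicalClosure ↔ X ≤ Y.topologicalClosure :=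
  ⟨fun h => X.le_topologicalClosure.trans h,
    fun h => X.topologicalClosure_minimal h Y.isClosed_topologicalClosure⟩

lemma tc_eq_iff {X Y : Submodule ℂ V} :
    X.topologicalClosure = Y.topologicalClosure ↔
      X ≤ Y.topologicalClosure ∧ Y ≤ X.topologicalClosure := by
  rw [le_antisymm_iff, tc_le_iff, tc_le_iff]

variable (V) in
/-- Subspaces up to closure. -/
def clCon : Con (Submodule ℂ V) where
  r X Y := X.topologicalClosure = Y.topologicalClosure
  iseqv := ⟨fun _ => rfl, fun h => h.symm, fun h h' => h.trans h'⟩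
  mul' := by
    intro X X' Y Y' h h'
    rw [tc_eq_iff] at h h' ⊢
    exact ⟨mul_le_tc h.1 h'.1, mul_le_tc h.2 h'.2⟩

variable (V) in
/-- The monoid of closed subspaces. -/
abbrev QM : Type _ := (clCon V).Quotient

/-- The closed subspace generated by a subspace. -/
def qm : Submodule ℂ V →* QM V := (clCon V).mk'

lemma qm_eq {X Y : Submodule ℂ V} :
    qm X = qm Y ↔ X.topologicalClosure = Y.topologicalClosure := (clCon V).eq

lemma qm_eq' {X Y : Submodule ℂ V} :
    qm X = qm Y ↔ X ≤ Y.topologicalClosure ∧ Y ≤ X.topologicalClosure := by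
  rw [qm_eq, tc_eq_iff]

lemma map_le_tc (φ : V →ₐ[ℂ] V') (hφ : Continuous φ) {X Y : Submodule ℂ V}
    (h : X ≤ Y.topologicalClosure) :
    X.map φ.toLinearMap ≤ (Y.map φ.toLinearMap).topologicalClosure := by
  rintro _ ⟨x, hx, rfl⟩
  have h1 : x ∈ closure (Y : Set V) := h hx
  exact map_mem_closure hφ h1 (fun a ha => ⟨a, ha, rfl⟩)

/-- Functoriality of the monoid of closed subspaces. -/
def qmap (φ : V →ₐ[ℂ] V') (hφ : Continuous φ) : QM V →* QM V' :=
  (clCon V).lift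
    { toFun := fun X => qm (X.map φ.toLinearMap)
      map_one' := by rw [Submodule.map_one, map_one]
      map_mul' := by intro X Y; rw [Submodule.map_mul, map_mul] }
    (by
      intro X Y h
      have h' : X.topologicalClosure = Y.topologicalClosure := h
      rw [tc_eq_iff] at h'
      change qm (X.map φ.toLinearMap) = qm (Y.map φ.toLinearMap)
      rw [qm_eq']
      exact ⟨map_le_tc φ hφ h'.1, map_le_tc φ hφ h'.2⟩)

lemma qmap_qm (φ : V →ₐ[ℂ] V') (hφ : Continuous φ) (X : Submodule ℂ V) :
    qmap φ hφ (qm X) = qm (X.map φ.toLinearMap) := rfl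

/-- The class of a single operator. -/
def qs (w : V) : QM V := qm (Submodule.span ℂ {w})

lemma qs_mul (v w : V) : qs v * qs w = qs (v * w) := by
  rw [qs, qs, ← map_mul, Submodule.span_mul_span, Set.singleton_mul_singleton, qs]

lemma qs_one : qs (1 : V) = 1 := by
  rw [qs, ← Submodule.one_eq_span, map_one]

lemma qmap_qs (φ : V →ₐ[ℂ] V') (hφ : Continuous φ) (w : V) : qmap φ hφ (qs w) = qs (φ w) := by
  rw [qs, qmap_qm, Submodule.map_span, Set.image_singleton]; rfl

lemma qm_comm {X Y : Submodule ℂ V} (h : ∀ x ∈ X, ∀ y ∈ Y, x * y = y * x) :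
    qm X * qm Y = qm Y * qm X := by
  rw [← map_mul, ← map_mul]
  congr 1
  apply le_antisymm
  · rw [Submodule.mul_le]
    intro x hx y hy
    rw [h x hx y hy]; exact Submodule.mul_mem_mul hy hx
  · rw [Submodule.mul_le]
    intro y hy x hx
    rw [← h x hx y hy]; exact Submodule.mul_mem_mul hx hy

variable [StarRing V] [StarModule ℂ V] [ContinuousStar V]

/-- Adjoint of a subspace. -/
def adj (X : Submodule ℂ V) : Submodule ℂ V where
  carrier := {x | star x ∈ X}
  zero_mem' := by simp
  add_mem' := by
    intro a b ha hb
    have : star (a + b) ∈ X := by rw [star_add]; exact X.add_mem ha hb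
    exact this
  smul_mem' := by
    intro c a ha
    have : star (c • a) ∈ X := by rw [star_smul]; exact X.smul_mem _ ha
    exact this

lemma mem_adj {X : Submodule ℂ V} {x : V} : x ∈ adj X ↔ star x ∈ X := Iff.rfl

lemma adj_adj (X : Submodule ℂ V) : adj (adj X) = X := by
  ext x; simp [mem_adj]

lemma adj_mono {X Y : Submodule ℂ V} (h : X ≤ Y) : adj X ≤ adj Y := fun _ hx => h hx

lemma adj_span (s : Set V) : adj (Submodule.span ℂ s) = Submodule.span ℂ (star '' s) := by
  apply le_antisymm
  · have h : Submodule.span ℂ s ≤ adj (Submodule.span ℂ (star '' s)) := by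
      rw [Submodule.span_le]
      intro x hx
      exact Submodule.subset_span ⟨x, hx, rfl⟩
    have := adj_mono h
    rwa [adj_adj] at this
  · rw [Submodule.span_le]
    rintro _ ⟨x, hx, rfl⟩
    change star (star x) ∈ Submodule.span ℂ s
    rw [star_star]; exact Submodule.subset_span hx

lemma adj_mul_le (X Y : Submodule ℂ V) : adj Y * adj X ≤ adj (X * Y) := by
  rw [Submodule.mul_le]
  intro y hy x hx
  rw [mem_adj, star_mul]
  exact Submodule.mul_mem_mul hx hy

lemma adj_mul (X Y : Submodule ℂ V) : adj (X * Y) = adj Y * adj X := by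
  refine le_antisymm ?_ (adj_mul_le X Y)
  have := adj_mono (adj_mul_le (adj Y) (adj X))
  rwa [adj_adj, adj_adj, adj_adj] at this

lemma adj_le_tc {X Y : Submodule ℂ V} (h : X ≤ Y.topologicalClosure) :
    adj X ≤ (adj Y).topologicalClosure := by
  intro x hx
  have h1 : star x ∈ closure (Y : Set V) := h hx
  have := map_mem_closure (t := (adj Y : Set V)) continuous_star h1
    (fun a ha => by
      have : star (star a) ∈ Y := by rw [star_star]; exact ha
      exact this)
  rwa [star_star] at this

/-- The adjoint on closed subspaces. -/
def qstar : QM V → QM V :=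
  fun x => Con.liftOn x (fun X => qm (adj X)) (by
    intro X Y h
    have h' : X.topologicalClosure = Y.topologicalClosure := h
    rw [tc_eq_iff] at h'
    rw [qm_eq']
    exact ⟨adj_le_tc h'.1, adj_le_tc h'.2⟩)

lemma qstar_qm (X : Submodule ℂ V) : qstar (qm X) = qm (adj X) := rfl

lemma qstar_mul (x y : QM V) : qstar (x * y) = qstar y * qstar x := by
  induction x using Con.induction_on with | H X =>
  induction y using Con.induction_on with | H Y =>
  change qstar (qm X * qm Y) = qstar (qm Y) * qstar (qm X)
  rw [← map_mul, qstar_qm, qstar_qm, qstar_qm, adj_mul, map_mul]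

lemma qstar_qstar (x : QM V) : qstar (qstar x) = x := by
  induction x using Con.induction_on with | H X =>
  change qstar (qstar (qm X)) = qm X
  rw [qstar_qm, qstar_qm, adj_adj]

lemma qstar_qs (w : V) : qstar (qs w) = qs (star w) := by
  rw [qs, qstar_qm, adj_span, Set.image_singleton, qs]

end quot

section words

variable {Q : Type*} [Monoid Q]

/-- The three basic consequences of regularity, as word manipulations. -/
lemma words_core {k1 k2 a3 s3 w12 w13 w23 u12 u13 : Q}
    (hu12 : u12 * w12 = 1) (hu12' : w12 * u12 = 1) (hu13 : u13 * w13 = 1)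
    (hp : w23 * w12 = w12 * w13 * w23)
    (k12 : k1 * k2 = k2 * k1) (k22 : k2 * k2 = k2) (k11 : k1 * k1 = k1)
    (s2 : k2 * s3 = s3 * k2)
    (w2 : k2 * w13 = w13 * k2) (v2 : k2 * u13 = u13 * k2) (w1 : k1 * w23 = w23 * k1)
    (b2 : w12 * (k1 * k2) = k1 * k2)
    (c1 : k1 * k2 * u12 = k1 * k2) (c2 : u12 * (k1 * k2) = k1 * k2)
    (r : k1 * w12 * k2 = k1 * k2) (r' : k2 * u12 * k1 = k1 * k2)
    (A : k2 * w23 * k2 = k2 * a3) (S : k1 * u13 * k1 = k1 * s3) :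
    k1 * k2 * (s3 * a3) = k1 * k2 * a3 ∧
    k2 * (k1 * w13 * a3) = k2 * (k1 * a3) ∧
    k2 * (w13 * k1 * a3) = k2 * (k1 * a3) := by
  have hq1 : w13 * w23 = u12 * w23 * w12 := by
    calc w13 * w23 = (u12 * w12) * w13 * w23 := by rw [hu12, one_mul]
      _ = u12 * (w12 * w13 * w23) := by simp only [mul_assoc]
      _ = _ := by rw [← hp, mul_assoc]
  have hq2 : u13 * u12 * w23 = w23 * u12 := by
    calc u13 * u12 * w23 = u13 * u12 * w23 * (w12 * u12) := by rw [hu12', mul_one]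
      _ = u13 * u12 * (w23 * w12) * u12 := by simp only [mul_assoc]
      _ = u13 * (u12 * w12) * w13 * w23 * u12 := by rw [hp]; simp only [mul_assoc]
      _ = w23 * u12 := by rw [hu12, mul_one, hu13, one_mul]
  have hkw : k2 * w13 = k2 * w13 * k2 := by rw [mul_assoc, ← w2, ← mul_assoc, k22]
  refine ⟨?_, ?_, ?_⟩
  · calc k1 * k2 * (s3 * a3) = k1 * (k2 * s3) * a3 := by simp only [mul_assoc]
      _ = (k1 * s3) * (k2 * a3) := by rw [s2]; simp only [mul_assoc]
      _ = k1 * u13 * (k1 * k2) * w23 * k2 := by rw [← A, ← S]; simp only [mul_assoc]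
      _ = k1 * (u13 * k2) * u12 * (k1 * w23) * k2 := by rw [← r']; simp only [mul_assoc]
      _ = k1 * k2 * (u13 * u12 * w23) * (k1 * k2) := by rw [← v2, w1]; simp only [mul_assoc]
      _ = k1 * k2 * w23 * (u12 * (k1 * k2)) := by rw [hq2]; simp only [mul_assoc]
      _ = k1 * k2 * (w23 * k1) * k2 := by rw [c2]; simp only [mul_assoc]
      _ = (k1 * k2) * k1 * w23 * k2 := by rw [← w1]; simp only [mul_assoc]
      _ = k2 * (k1 * k1) * w23 * k2 := by rw [k12]; simp only [mul_assoc]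
      _ = (k1 * k2) * w23 * k2 := by rw [k11, k12]
      _ = k1 * (k2 * w23 * k2) := by simp only [mul_assoc]
      _ = _ := by rw [A, mul_assoc]
  · calc k2 * (k1 * w13 * a3) = (k2 * k1) * w13 * a3 := by simp only [mul_assoc]
      _ = k1 * (k2 * w13) * a3 := by rw [← k12]; simp only [mul_assoc]
      _ = k1 * w13 * (k2 * a3) := by rw [w2]; simp only [mul_assoc]
      _ = k1 * (w13 * k2) * w23 * k2 := by rw [← A]; simp only [mul_assoc]
      _ = k1 * k2 * (w13 * w23) * k2 := by rw [← w2]; simp only [mul_assoc]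
      _ = k1 * k2 * u12 * w23 * w12 * k2 := by rw [hq1]; simp only [mul_assoc]
      _ = k2 * (k1 * w23) * w12 * k2 := by rw [c1, k12]; simp only [mul_assoc]
      _ = k2 * w23 * (k1 * w12 * k2) := by rw [w1]; simp only [mul_assoc]
      _ = k2 * (w23 * k1) * k2 := by rw [r]; simp only [mul_assoc]
      _ = (k2 * k1) * w23 * k2 := by rw [← w1]; simp only [mul_assoc]
      _ = k1 * (k2 * w23 * k2) := by rw [← k12]; simp only [mul_assoc]
      _ = _ := by rw [A, ← mul_assoc, k12, mul_assoc]
  · calc k2 * (w13 * k1 * a3) = (k2 * w13) * (k1 * a3) := by simp only [mul_assoc]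
      _ = (k2 * w13 * k2) * (k1 * a3) := by rw [← hkw]
      _ = k2 * w13 * (k2 * k1) * a3 := by simp only [mul_assoc]
      _ = k2 * w13 * k1 * (k2 * a3) := by rw [← k12]; simp only [mul_assoc]
      _ = k2 * w13 * (k1 * k2) * w23 * k2 := by rw [← A]; simp only [mul_assoc]
      _ = k2 * (w13 * k2) * (k1 * w23) * k2 := by rw [k12]; simp only [mul_assoc]
      _ = (k2 * k2) * (w13 * w23) * (k1 * k2) := by rw [← w2, w1]; simp only [mul_assoc]
      _ = k2 * u12 * w23 * (w12 * (k1 * k2)) := by rw [hq1, k22]; simp only [mul_assoc]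
      _ = k2 * u12 * (w23 * k1) * k2 := by rw [b2]; simp only [mul_assoc]
      _ = (k2 * u12 * k1) * w23 * k2 := by rw [← w1]; simp only [mul_assoc]
      _ = k1 * (k2 * w23 * k2) := by rw [r']; simp only [mul_assoc]
      _ = _ := by rw [A, ← mul_assoc, k12, mul_assoc]

/-- The final word manipulations. -/
lemma words_final {k2 h1 a3 w12 w13 w23 u12 u23 : Q}
    (hu12 : u12 * w12 = 1) (hu23' : w23 * u23 = 1)
    (hp : w23 * w12 = w12 * w13 * w23)
    (kh : k2 * h1 = h1 * k2) (ka : k2 * a3 = a3 * k2)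
    (w2 : k2 * w13 = w13 * k2) (wa : a3 * w12 = w12 * a3) (wh : h1 * w23 = w23 * h1)
    (uh : h1 * u23 = u23 * h1) (ua : a3 * u12 = u12 * a3)
    (A : k2 * w12 * k2 = k2 * h1)
    (e1 : k2 * w23 * a3 = k2 * a3) (e2 : w23 * (k2 * a3) = k2 * a3) (e2u : u23 * (k2 * a3) = k2 * a3)
    (e3 : k2 * a3 * w23 = k2 * a3) (e3u : k2 * a3 * u23 = k2 * a3)
    (f1 : w12 * (k2 * h1) = k2 * h1) (f1u : u12 * (k2 * h1) = k2 * h1)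
    (f2 : k2 * h1 * w12 = k2 * h1) (f2u : k2 * h1 * u12 = k2 * h1) :
    k2 * (h1 * w13 * a3) = k2 * (h1 * a3) ∧
    k2 * (w13 * (h1 * a3)) = k2 * (h1 * a3) ∧
    k2 * (h1 * a3 * w13) = k2 * (h1 * a3) := by
  have hq : w12 * w13 = w23 * w12 * u23 := by
    calc w12 * w13 = w12 * w13 * (w23 * u23) := by rw [hu23', mul_one]
      _ = (w12 * w13 * w23) * u23 := by simp only [mul_assoc]
      _ = _ := by rw [← hp]
  have hq' : w13 = u12 * w23 * w12 * u23 := by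
    calc w13 = u12 * w12 * w13 := by rw [hu12, one_mul]
      _ = u12 * (w12 * w13) := by simp only [mul_assoc]
      _ = _ := by rw [hq]; simp only [mul_assoc]
  refine ⟨?_, ?_, ?_⟩
  · calc k2 * (h1 * w13 * a3) = (k2 * h1) * w13 * a3 := by simp only [mul_assoc]
      _ = k2 * w12 * (k2 * w13) * a3 := by rw [← A]; simp only [mul_assoc]
      _ = k2 * (w12 * w13) * (k2 * a3) := by rw [w2]; simp only [mul_assoc]
      _ = k2 * w23 * w12 * (u23 * (k2 * a3)) := by rw [hq]; simp only [mul_assoc]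
      _ = k2 * w23 * (w12 * a3) * k2 := by rw [e2u, ka]; simp only [mul_assoc]
      _ = k2 * w23 * a3 * w12 * k2 := by rw [← wa]; simp only [mul_assoc]
      _ = k2 * (a3 * w12) * k2 := by rw [e1]; simp only [mul_assoc]
      _ = k2 * w12 * (k2 * a3) := by rw [wa, ka]; simp only [mul_assoc]
      _ = (k2 * w12 * k2) * a3 := by simp only [mul_assoc]
      _ = _ := by rw [A, mul_assoc]
  · calc k2 * (w13 * (h1 * a3)) = (k2 * w13) * (h1 * a3) := by simp only [mul_assoc]
      _ = w13 * (k2 * h1) * a3 := by rw [w2]; simp only [mul_assoc]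
      _ = w13 * h1 * (k2 * a3) := by rw [kh]; simp only [mul_assoc]
      _ = u12 * w23 * w12 * (u23 * h1) * (k2 * a3) := by rw [hq']; simp only [mul_assoc]
      _ = u12 * w23 * w12 * h1 * (u23 * (k2 * a3)) := by rw [← uh]; simp only [mul_assoc]
      _ = u12 * w23 * w12 * (h1 * k2) * a3 := by rw [e2u]; simp only [mul_assoc]
      _ = u12 * w23 * (w12 * (k2 * h1)) * a3 := by rw [← kh]; simp only [mul_assoc]
      _ = u12 * w23 * (h1 * k2) * a3 := by rw [f1, kh]
      _ = u12 * (w23 * h1) * (k2 * a3) := by simp only [mul_assoc]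
      _ = u12 * h1 * (w23 * (k2 * a3)) := by rw [← wh]; simp only [mul_assoc]
      _ = u12 * (h1 * k2) * a3 := by rw [e2]; simp only [mul_assoc]
      _ = (u12 * (k2 * h1)) * a3 := by rw [← kh]
      _ = _ := by rw [f1u, mul_assoc]
  · calc k2 * (h1 * a3 * w13) = k2 * h1 * a3 * u12 * w23 * w12 * u23 := by
          rw [hq']; simp only [mul_assoc]
      _ = k2 * h1 * (a3 * u12) * w23 * w12 * u23 := by simp only [mul_assoc]
      _ = (k2 * h1 * u12) * a3 * w23 * w12 * u23 := by rw [ua]; simp only [mul_assoc]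
      _ = h1 * (k2 * a3 * w23) * w12 * u23 := by rw [f2u, kh]; simp only [mul_assoc]
      _ = h1 * k2 * (a3 * w12) * u23 := by rw [e3]; simp only [mul_assoc]
      _ = (k2 * h1 * w12) * a3 * u23 := by rw [wa, kh]; simp only [mul_assoc]
      _ = h1 * (k2 * a3 * u23) := by rw [f2, kh]; simp only [mul_assoc]
      _ = _ := by rw [e3u, ← mul_assoc, ← kh, mul_assoc]

end words


section frank

variable {E : Type*} [NormedAddCommGroup E] [InnerProductSpace ℂ E]

variable (E) in
/-- Finite rank operators. -/
def FR : Submodule ℂ (E →L[ℂ] E) :=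
  Submodule.span ℂ {T | ∃ a b : E, T = InnerProductSpace.rankOne ℂ a b}

lemma rankOne_mem_FR (a b : E) : InnerProductSpace.rankOne ℂ a b ∈ FR E :=
  Submodule.subset_span ⟨a, b, rfl⟩

lemma rankOne_mul_rankOne (a b c d : E) :
    (InnerProductSpace.rankOne ℂ a b : E →L[ℂ] E) * InnerProductSpace.rankOne ℂ c d
      = ⟪b, c⟫_ℂ • InnerProductSpace.rankOne ℂ a d := by
  ext z
  simp [InnerProductSpace.rankOne_apply, smul_smul, mul_comm]

lemma FR_mul_FR : FR E * FR E = FR E := by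
  apply le_antisymm
  · rw [FR, Submodule.span_mul_span, Submodule.span_le]
    rintro _ ⟨_, ⟨a, b, rfl⟩, _, ⟨c, d, rfl⟩, rfl⟩
    simp only [rankOne_mul_rankOne]
    exact Submodule.smul_mem _ _ (rankOne_mem_FR _ _)
  · conv_lhs => rw [FR]
    rw [Submodule.span_le]
    rintro _ ⟨a, b, rfl⟩
    by_cases hb : b = 0
    · subst hb; simp
    · have h : (⟪b, b⟫_ℂ)⁻¹ • ((InnerProductSpace.rankOne ℂ a b : E →L[ℂ] E) *
          InnerProductSpace.rankOne ℂ b b) = InnerProductSpace.rankOne ℂ a b := by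
        rw [rankOne_mul_rankOne, smul_smul, inv_mul_cancel₀, one_smul]
        exact inner_self_ne_zero.2 hb
      rw [← h]
      exact Submodule.smul_mem _ _
        (Submodule.mul_mem_mul (rankOne_mem_FR _ _) (rankOne_mem_FR _ _))

lemma mul_rankOne (T : E →L[ℂ] E) (a b : E) :
    T * InnerProductSpace.rankOne ℂ a b = InnerProductSpace.rankOne ℂ (T a) b := by
  ext z; simp [InnerProductSpace.rankOne_apply]

variable [CompleteSpace E]

lemma star_rankOne (a b : E) :
    star (InnerProductSpace.rankOne ℂ a b : E →L[ℂ] E) = InnerProductSpace.rankOne ℂ b a := by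
  rw [ContinuousLinearMap.star_eq_adjoint, InnerProductSpace.adjoint_rankOne]

lemma adj_FR : adj (FR E) = FR E := by
  rw [FR, adj_span]
  congr 1
  ext T
  constructor
  · rintro ⟨_, ⟨a, b, rfl⟩, rfl⟩
    exact ⟨b, a, star_rankOne a b⟩
  · rintro ⟨a, b, rfl⟩
    exact ⟨_, ⟨b, a, rfl⟩, star_rankOne b a⟩

lemma qs_mul_FR {U V : E →L[ℂ] E} (h : U * V = 1) : qs U * qm (FR E) = qm (FR E) := by
  rw [qs, ← map_mul]
  congr 1
  apply le_antisymm
  · conv_lhs => rw [FR]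
    rw [Submodule.span_mul_span, Submodule.span_le]
    rintro _ ⟨_, rfl, _, ⟨a, b, rfl⟩, rfl⟩
    simp only [mul_rankOne]
    exact rankOne_mem_FR _ _
  · conv_lhs => rw [FR]
    rw [Submodule.span_le]
    rintro _ ⟨a, b, rfl⟩
    have : (InnerProductSpace.rankOne ℂ a b : E →L[ℂ] E)
        = U * InnerProductSpace.rankOne ℂ (V a) b := by
      rw [mul_rankOne, ← mul_apply_eq_comp, h]; rfl
    rw [this]
    exact Submodule.mul_mem_mul (Submodule.mem_span_singleton_self _) (rankOne_mem_FR _ _)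

lemma FR_mul_qs {U V : E →L[ℂ] E} (h : V * U = 1) : qm (FR E) * qs U = qm (FR E) := by
  have h1 : star U * star V = 1 := by rw [← star_mul, h, star_one]
  have := congrArg qstar (qs_mul_FR h1)
  rwa [qstar_mul, qstar_qs, star_star, qstar_qm, adj_FR] at this

/-- Compact operators are norm limits of finite rank operators. -/
lemma compact_eq_closure_FR :
    {T : E →L[ℂ] E | IsCompactOperator T} = ((FR E).topologicalClosure : Set (E →L[ℂ] E)) := by
  apply Set.Subset.antisymm
  · intro T hT
    have hT' : IsCompactOperator T := hT
    change T ∈ closure (FR E : Set (E →L[ℂ] E))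
    rw [Metric.mem_closure_iff]
    intro ε hε
    have htb : TotallyBounded (T '' Metric.closedBall 0 1) := by
      have h1 := hT'.isCompact_closure_image_closedBall (𝕜₁ := ℂ) 1
      exact h1.totallyBounded.subset subset_closure
    obtain ⟨s, hs, hcov⟩ := Metric.totallyBounded_iff.1 htb (ε / 2) (by positivity)
    let U : Submodule ℂ E := Submodule.span ℂ s
    have : FiniteDimensional ℂ U := FiniteDimensional.span_of_finite ℂ hs
    refine ⟨U.starProjection * T, ?_, ?_⟩
    · let b := stdOrthonormalBasis ℂ U
      have hb : U.starProjection = ∑ i, InnerProductSpace.rankOne ℂ (b i : E) (b i : E) :=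
        b.starProjection_eq_sum_rankOne
      rw [hb, Finset.sum_mul]
      refine Submodule.sum_mem _ fun i _ => ?_
      have : (InnerProductSpace.rankOne ℂ (b i : E) (b i : E)) * T
          = InnerProductSpace.rankOne ℂ (b i : E) (adjoint T (b i)) := by
        ext z; simp [InnerProductSpace.rankOne_apply, ContinuousLinearMap.adjoint_inner_left]
      rw [this]
      exact rankOne_mem_FR _ _
    · rw [dist_eq_norm]
      refine lt_of_le_of_lt (ContinuousLinearMap.opNorm_le_of_unit_norm (C := ε / 2)
        (by positivity) ?_) (by linarith)
      intro x hx
      have hx' : T x ∈ T '' Metric.closedBall 0 1 := ⟨x, by simp [hx], rfl⟩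
      have := hcov hx'
      simp only [Set.mem_iUnion, Metric.mem_ball] at this
      obtain ⟨y, hy, hd⟩ := this
      have hyU : y ∈ U := Submodule.subset_span hy
      have h2 : ‖T x - U.starProjection (T x)‖ ≤ ‖T x - y‖ := by
        have := U.starProjection_minimal (T x)
        rw [this]
        exact ciInf_le (f := fun w : U => ‖T x - w‖)
          ⟨0, by rintro _ ⟨w, rfl⟩; exact norm_nonneg _⟩ ⟨y, hyU⟩
      rw [dist_eq_norm] at hd
      exact h2.trans hd.le
  · refine closure_minimal ?_ isClosed_setOfPred_isCompactOperator
    intro T hT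
    change IsCompactOperator T
    induction hT using Submodule.span_induction with
    | mem T hT =>
      obtain ⟨a, b, rfl⟩ := hT
      have h1 : IsCompactOperator (ContinuousLinearMap.toSpanSingleton ℂ a) :=
        isCompactOperator_of_locallyCompactSpace_rng _
      exact h1.comp_clm (innerSL ℂ b)
    | zero => exact isCompactOperator_zero
    | add x y _ _ hx hy => exact hx.add hy
    | smul c x _ hx => exact hx.smul c

end frank

set_option linter.unusedSectionVars false
namespace TensorPair

variable {E F G : Type*}
  [NormedAddCommGroup E] [InnerProductSpace ℂ E] [CompleteSpace E]
  [NormedAddCommGroup F] [InnerProductSpace ℂ F] [CompleteSpace F]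
  [NormedAddCommGroup G] [InnerProductSpace ℂ G] [CompleteSpace G]

/-- Class of `X ⊗ 1`. -/
def qL (p : TensorPair E F G) (X : Submodule ℂ (E →L[ℂ] E)) : QM (G →L[ℂ] G) :=
  qm (X.map p.opL.toLinearMap)

/-- Class of `1 ⊗ X`. -/
def qR (p : TensorPair E F G) (X : Submodule ℂ (F →L[ℂ] F)) : QM (G →L[ℂ] G) :=
  qm (X.map p.opR.toLinearMap)

lemma flip_qL (p : TensorPair E F G) (X : Submodule ℂ (F →L[ℂ] F)) : p.flip.qL X = p.qR X := rfl
lemma flip_qR (p : TensorPair E F G) (X : Submodule ℂ (E →L[ℂ] E)) : p.flip.qR X = p.qL X := rfl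

lemma qL_mul (p : TensorPair E F G) (X Y : Submodule ℂ (E →L[ℂ] E)) :
    p.qL (X * Y) = p.qL X * p.qL Y := by
  rw [qL, Submodule.map_mul, map_mul]; rfl

lemma qR_mul (p : TensorPair E F G) (X Y : Submodule ℂ (F →L[ℂ] F)) :
    p.qR (X * Y) = p.qR X * p.qR Y := p.flip.qL_mul X Y

lemma qL_congr (p : TensorPair E F G) {X Y : Submodule ℂ (E →L[ℂ] E)} (h : qm X = qm Y) :
    p.qL X = p.qL Y := congrArg (qmap p.opL p.opL_cont) h

lemma qR_congr (p : TensorPair E F G) {X Y : Submodule ℂ (F →L[ℂ] F)} (h : qm X = qm Y) :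
    p.qR X = p.qR Y := p.flip.qL_congr h

lemma qL_qR (p : TensorPair E F G) (X : Submodule ℂ (E →L[ℂ] E)) (Y : Submodule ℂ (F →L[ℂ] F)) :
    p.qL X * p.qR Y = p.qR Y * p.qL X := by
  apply qm_comm
  rintro _ ⟨x, _, rfl⟩ _ ⟨y, _, rfl⟩
  exact p.opL_opR x y

lemma qs_opL_qR (p : TensorPair E F G) (x : E →L[ℂ] E) (Y : Submodule ℂ (F →L[ℂ] F)) :
    p.qR Y * qs (p.opL x) = qs (p.opL x) * p.qR Y := by
  apply qm_comm
  rintro _ ⟨y, _, rfl⟩ _ hx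
  obtain ⟨c, rfl⟩ := Submodule.mem_span_singleton.1 hx
  rw [mul_smul_comm, smul_mul_assoc]
  congr 1
  exact (p.opL_opR x y).symm

lemma qstar_qL (p : TensorPair E F G) (X : Submodule ℂ (E →L[ℂ] E)) :
    qstar (p.qL X) = p.qL (adj X) := by
  rw [qL, qstar_qm, qL]
  congr 1
  ext T
  constructor
  · rintro ⟨x, hx, h⟩
    refine ⟨star x, by simpa [mem_adj] using hx, ?_⟩
    have h' : p.opL x = star T := h
    change p.opL (star x) = T
    rw [← p.opL_star, h', star_star]
  · rintro ⟨x, hx, rfl⟩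
    exact ⟨star x, hx, (p.opL_star x).symm⟩

lemma qstar_qR (p : TensorPair E F G) (X : Submodule ℂ (F →L[ℂ] F)) :
    qstar (p.qR X) = p.qR (adj X) := p.flip.qstar_qL X

/-- The adjoint of `insL`. -/
def dL (p : TensorPair E F G) (b : E) : G →L[ℂ] F := adjoint (p.insL b)

@[simp] lemma dL_tmul (p : TensorPair E F G) (b c : E) (d : F) :
    p.dL b (p.tmul c d) = ⟪b, c⟫_ℂ • d := by
  apply ext_inner_left ℂ
  intro v
  rw [dL, ContinuousLinearMap.adjoint_inner_right, insL_apply, p.inner_tmul, inner_smul_right]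

@[simp] lemma flip_dL_tmul (p : TensorPair E F G) (b : F) (c : E) (d : F) :
    p.flip.dL b (p.tmul c d) = ⟪b, d⟫_ℂ • c := p.flip.dL_tmul b d c

lemma opL_rankOne (p : TensorPair E F G) (a b : E) :
    p.opL (InnerProductSpace.rankOne ℂ a b) = p.insL a ∘L p.dL b := by
  apply p.ext_op; intro c d
  simp [InnerProductSpace.rankOne_apply]

lemma map_FR_opL (p : TensorPair E F G) : (FR E).map p.opL.toLinearMap =
    Submodule.span ℂ {T | ∃ a b, T = p.insL a ∘L p.dL b} := by
  rw [FR, Submodule.map_span]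
  congr 1
  ext T
  constructor
  · rintro ⟨_, ⟨a, b, rfl⟩, rfl⟩
    exact ⟨a, b, p.opL_rankOne a b⟩
  · rintro ⟨a, b, rfl⟩
    exact ⟨_, ⟨a, b, rfl⟩, p.opL_rankOne a b⟩

lemma mem_slicesL (p : TensorPair E F G) (X : G →L[ℂ] G) (T : F →L[ℂ] F) :
    T ∈ slicesL p p X ↔ ∃ ξ η, T = p.dL ξ ∘L X ∘L p.insL η := by
  constructor
  · rintro ⟨ξ, η, h⟩
    refine ⟨ξ, η, ?_⟩
    ext z
    apply ext_inner_left ℂ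
    intro v
    rw [h]
    simp [dL, ContinuousLinearMap.adjoint_inner_right]
  · rintro ⟨ξ, η, rfl⟩
    refine ⟨ξ, η, ?_⟩
    intro v z
    simp [dL, ContinuousLinearMap.adjoint_inner_right]

/-- Slices. -/
def SL (p : TensorPair E F G) (X : G →L[ℂ] G) : Submodule ℂ (F →L[ℂ] F) :=
  Submodule.span ℂ (slicesL p p X)

lemma slice_id (p : TensorPair E F G) (X : G →L[ℂ] G) (a b c d : E) :
    (p.insL a ∘L p.dL b) * X * (p.insL c ∘L p.dL d)
      = (p.insL a ∘L p.dL d) * p.opR (p.dL b ∘L X ∘L p.insL c) := by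
  apply p.ext_op; intro x y
  simp

lemma qL_qs_qL (p : TensorPair E F G) (X : G →L[ℂ] G) :
    p.qL (FR E) * qs X * p.qL (FR E) = p.qL (FR E) * p.qR (p.SL X) := by
  rw [qL, qs, qR, ← map_mul, ← map_mul, ← map_mul, map_FR_opL, SL, Submodule.map_span,
    Submodule.span_mul_span, Submodule.span_mul_span, Submodule.span_mul_span]
  congr 2
  ext T
  constructor
  · rintro ⟨_, ⟨_, ⟨a, b, rfl⟩, _, rfl, rfl⟩, _, ⟨c, d, rfl⟩, rfl⟩
    exact ⟨_, ⟨a, d, rfl⟩, _, ⟨_, (p.mem_slicesL _ _).2 ⟨b, c, rfl⟩, rfl⟩,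
      (p.slice_id _ a b c d).symm⟩
  · rintro ⟨_, ⟨a, d, rfl⟩, _, ⟨_, hT, rfl⟩, rfl⟩
    obtain ⟨b, c, rfl⟩ := (p.mem_slicesL X _).1 hT
    exact ⟨_, ⟨_, ⟨a, b, rfl⟩, _, rfl, rfl⟩, _, ⟨c, d, rfl⟩, p.slice_id X a b c d⟩

lemma SL_star (p : TensorPair E F G) (X : G →L[ℂ] G) : p.SL (star X) = adj (p.SL X) := by
  rw [SL, SL, adj_span]
  congr 1
  have key : ∀ ξ η, star (p.dL ξ ∘L X ∘L p.insL η) = p.dL η ∘L star X ∘L p.insL ξ := by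
    intro ξ η
    simp only [ContinuousLinearMap.star_eq_adjoint, ContinuousLinearMap.adjoint_comp, dL,
      ContinuousLinearMap.adjoint_adjoint, ContinuousLinearMap.comp_assoc]
  ext T
  rw [p.mem_slicesL]
  constructor
  · rintro ⟨ξ, η, rfl⟩
    exact ⟨_, (p.mem_slicesL X _).2 ⟨η, ξ, rfl⟩, key _ _⟩
  · rintro ⟨_, hT, rfl⟩
    obtain ⟨b, c, rfl⟩ := (p.mem_slicesL X _).1 hT
    exact ⟨c, b, key _ _⟩

lemma opL_opR_rankOne (p : TensorPair E F G) (a b : E) (c d : F) :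
    p.opL (InnerProductSpace.rankOne ℂ a b) * p.opR (InnerProductSpace.rankOne ℂ c d)
      = InnerProductSpace.rankOne ℂ (p.tmul a c) (p.tmul b d) := by
  apply p.ext_op; intro x y
  simp [InnerProductSpace.rankOne_apply, p.inner_tmul, smul_smul, mul_comm]

lemma qL_FR_mul_qR_FR (p : TensorPair E F G) :
    p.qL (FR E) * p.qR (FR F) = qm (FR G) := by
  rw [qL, qR, ← map_mul, qm_eq']
  constructor
  · refine le_trans ?_ (Submodule.le_topologicalClosure _)
    rw [FR, FR, Submodule.map_span, Submodule.map_span, Submodule.span_mul_span, Submodule.span_le]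
    rintro _ ⟨_, ⟨_, ⟨a, b, rfl⟩, rfl⟩, _, ⟨_, ⟨c, d, rfl⟩, rfl⟩, rfl⟩
    have := p.opL_opR_rankOne a b c d
    have h2 := rankOne_mem_FR (p.tmul a c) (p.tmul b d)
    rw [← this] at h2
    exact h2
  · conv_lhs => rw [FR]
    rw [Submodule.span_le]
    rintro _ ⟨x, y, rfl⟩
    have hx := p.dense_span x
    have hy := p.dense_span y
    have hc : Continuous (Function.uncurry fun x y : G =>
        (InnerProductSpace.rankOne ℂ x y : G →L[ℂ] G)) := by
      change Continuous (fun p : G × G => (innerSL ℂ p.2).smulRight p.1)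
      fun_prop
    refine map_mem_closure₂ (f := fun x y : G =>
        (InnerProductSpace.rankOne ℂ x y : G →L[ℂ] G)) hc hx hy ?_
    intro x hx y hy
    simp only [SetLike.mem_coe] at hx hy ⊢
    induction hx using Submodule.span_induction with
    | zero => simp
    | add u v _ _ hu hv => rw [map_add, _root_.add_apply]; exact Submodule.add_mem _ hu hv
    | smul c u _ hu => rw [map_smul, _root_.smul_apply]; exact Submodule.smul_mem _ _ hu
    | mem u hu =>
      obtain ⟨a, c, rfl⟩ := hu
      induction hy using Submodule.span_induction with
      | zero => simp
      | add u v _ _ hu hv => rw [map_add]; exact Submodule.add_mem _ hu hv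
      | smul c u _ hu => rw [map_smulₛₗ]; exact Submodule.smul_mem _ _ hu
      | mem u hu =>
        obtain ⟨b, d, rfl⟩ := hu
        rw [← p.opL_opR_rankOne]
        exact Submodule.mul_mem_mul ⟨_, rankOne_mem_FR _ _, rfl⟩ ⟨_, rankOne_mem_FR _ _, rfl⟩

lemma descent_le [Nontrivial F] (p : TensorPair E F G) {X Y : Submodule ℂ (E →L[ℂ] E)}
    (h : X.map p.opL.toLinearMap * (FR F).map p.opR.toLinearMap ≤
      (Y.map p.opL.toLinearMap * (FR F).map p.opR.toLinearMap).topologicalClosure) :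
    X ≤ Y.topologicalClosure := by
  obtain ⟨ξ, hξ⟩ := exists_norm_eq F (c := 1) zero_le_one
  have hξ' : ⟪ξ, ξ⟫_ℂ = 1 := by rw [inner_self_eq_norm_sq_to_K, hξ]; simp
  let Φ : (G →L[ℂ] G) →ₗ[ℂ] (E →L[ℂ] E) :=
    { toFun := fun T => p.flip.dL ξ ∘L T ∘L p.flip.insL ξ
      map_add' := by intro S T; ext; simp
      map_smul' := by intro S T; ext; simp }
  have hΦ : Continuous Φ := by
    change Continuous (fun T : G →L[ℂ] G => p.flip.dL ξ ∘L T ∘L p.flip.insL ξ)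
    fun_prop
  have key : ∀ (x : E →L[ℂ] E) (c d : F), Φ (p.opL x * p.opR (InnerProductSpace.rankOne ℂ c d))
      = (⟪d, ξ⟫_ℂ * ⟪ξ, c⟫_ℂ) • x := by
    intro x c d
    ext z
    change p.flip.dL ξ ((p.opL x * p.opR (InnerProductSpace.rankOne ℂ c d)) (p.tmul z ξ)) = _
    simp [InnerProductSpace.rankOne_apply, smul_smul]
  intro x hx
  have h1 := h (Submodule.mul_mem_mul ⟨x, hx, rfl⟩ ⟨_, rankOne_mem_FR ξ ξ, rfl⟩)
  have h2 := map_mem_closure (t := (Y : Set (E →L[ℂ] E))) hΦ h1 (by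
    have : Y.map p.opL.toLinearMap * (FR F).map p.opR.toLinearMap ≤ Y.comap Φ := by
      rw [Submodule.mul_le]
      rintro _ ⟨y, hy, rfl⟩ _ ⟨k, hk, rfl⟩
      rw [Submodule.mem_comap]
      induction hk using Submodule.span_induction with
      | zero => simp
      | add u v _ _ hu hv =>
        rw [map_add, mul_add, map_add]; exact Submodule.add_mem _ hu hv
      | smul c u _ hu =>
        rw [map_smul, mul_smul_comm, map_smul]; exact Submodule.smul_mem _ _ hu
      | mem u hu =>
        obtain ⟨c, d, rfl⟩ := hu
        have := key y c d
        have h3 := Y.smul_mem (⟪d, ξ⟫_ℂ * ⟪ξ, c⟫_ℂ) hy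
        rw [← this] at h3
        exact h3
    exact this)
  have h3 : Φ (p.opL x * p.opR (InnerProductSpace.rankOne ℂ ξ ξ)) = x := by
    rw [key, hξ']; simp
  rw [← h3]
  exact h2

lemma descent [Nontrivial F] (p : TensorPair E F G) {X Y : Submodule ℂ (E →L[ℂ] E)}
    (h : p.qL X * p.qR (FR F) = p.qL Y * p.qR (FR F)) : qm X = qm Y := by
  rw [qL, qL, qR, ← map_mul, ← map_mul, qm_eq'] at h
  rw [qm_eq']
  exact ⟨p.descent_le h.1, p.descent_le h.2⟩

/-- Descent for arbitrary classes. -/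
lemma descent' [Nontrivial F] (p : TensorPair E F G) {x y : QM (E →L[ℂ] E)}
    (h : p.qR (FR F) * qmap p.opL p.opL_cont x = p.qR (FR F) * qmap p.opL p.opL_cont y) :
    x = y := by
  induction x using Con.induction_on with | H X =>
  induction y using Con.induction_on with | H Y =>
  have h' : p.qR (FR F) * p.qL X = p.qR (FR F) * p.qL Y := h
  rw [← qL_qR, ← qL_qR] at h'
  exact p.descent h'

end TensorPair

lemma reg_qm {H H2 : Type*}
    [NormedAddCommGroup H] [InnerProductSpace ℂ H] [CompleteSpace H]
    [NormedAddCommGroup H2] [InnerProductSpace ℂ H2] [CompleteSpace H2]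
    (t2 : TensorPair H H H2) (W Sg : H2 →L[ℂ] H2)
    (hSg : ∀ a b : H, Sg (t2.tmul a b) = t2.tmul b a)
    (hreg : hatA t2 (Sg * W) = {T : H →L[ℂ] H | IsCompactOperator T}) :
    t2.qL (FR H) * qs W * t2.qR (FR H) = t2.qL (FR H) * t2.qR (FR H) := by
  have hd : ∀ ξ, t2.flip.dL ξ ∘L Sg = t2.dL ξ := by
    intro ξ; apply t2.ext_op; intro a b; simp [hSg]
  have hsl : ∀ T, T ∈ slicesR t2 t2 (Sg * W) ↔ ∃ ξ η, T = t2.dL ξ ∘L W ∘L t2.flip.insL η := by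
    intro T
    have : T ∈ slicesR t2 t2 (Sg * W) ↔ T ∈ slicesL t2.flip t2.flip (Sg * W) := Iff.rfl
    rw [this, TensorPair.mem_slicesL]
    have h2 : ∀ ξ η, t2.flip.dL ξ ∘L (Sg * W) ∘L t2.flip.insL η
        = t2.dL ξ ∘L W ∘L t2.flip.insL η := by
      intro ξ η; rw [← hd]; rfl
    simp only [h2]
  rw [compact_eq_closure_FR] at hreg
  have hreg' : closure ((Submodule.span ℂ (slicesR t2 t2 (Sg * W)) : Submodule ℂ _) :
    Set (H →L[ℂ] H)) = closure (FR H : Set (H →L[ℂ] H)) := hreg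
  let Ψ (a d : H) : (H →L[ℂ] H) →ₗ[ℂ] (H2 →L[ℂ] H2) :=
    { toFun := fun T => t2.insL a ∘L T ∘L t2.flip.dL d
      map_add' := by intro S T; ext; simp
      map_smul' := by intro S T; ext; simp }
  have hΨ : ∀ a d, Continuous (Ψ a d) := by
    intro a d
    change Continuous (fun T : H →L[ℂ] H => t2.insL a ∘L T ∘L t2.flip.dL d)
    fun_prop
  have k1 : ∀ a b c d, Ψ a d (InnerProductSpace.rankOne ℂ c b) =
      (t2.insL a ∘L t2.dL b) * (t2.flip.insL c ∘L t2.flip.dL d) := by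
    intro a b c d
    apply t2.ext_op; intro x y
    change t2.insL a (InnerProductSpace.rankOne ℂ c b (t2.flip.dL d (t2.tmul x y))) = _
    simp [InnerProductSpace.rankOne_apply]
  have k2 : ∀ a b c d, Ψ a d (t2.dL b ∘L W ∘L t2.flip.insL c) =
      (t2.insL a ∘L t2.dL b) * W * (t2.flip.insL c ∘L t2.flip.dL d) := by
    intro a b c d; rfl
  have e1 : t2.qL (FR H) * qs W * t2.qR (FR H) = qm (Submodule.span ℂ
      {T | ∃ a b c d, T = Ψ a d (t2.dL b ∘L W ∘L t2.flip.insL c)}) := by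
    rw [← TensorPair.flip_qL, TensorPair.qL, qs, TensorPair.qL, ← map_mul, ← map_mul,
      TensorPair.map_FR_opL, TensorPair.map_FR_opL, Submodule.span_mul_span,
      Submodule.span_mul_span]
    congr 2
    ext T
    constructor
    · rintro ⟨_, ⟨_, ⟨a, b, rfl⟩, _, rfl, rfl⟩, _, ⟨c, d, rfl⟩, rfl⟩
      exact ⟨a, b, c, d, (k2 a b c d).symm⟩
    · rintro ⟨a, b, c, d, rfl⟩
      exact ⟨_, ⟨_, ⟨a, b, rfl⟩, _, rfl, rfl⟩, _, ⟨c, d, rfl⟩, rfl⟩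
  have e2 : t2.qL (FR H) * t2.qR (FR H) = qm (Submodule.span ℂ
      {T | ∃ a b c d, T = Ψ a d (InnerProductSpace.rankOne ℂ c b)}) := by
    rw [← TensorPair.flip_qL, TensorPair.qL, TensorPair.qL, ← map_mul,
      TensorPair.map_FR_opL, TensorPair.map_FR_opL, Submodule.span_mul_span]
    congr 2
    ext T
    constructor
    · rintro ⟨_, ⟨a, b, rfl⟩, _, ⟨c, d, rfl⟩, rfl⟩
      exact ⟨a, b, c, d, (k1 a b c d).symm⟩
    · rintro ⟨a, b, c, d, rfl⟩
      exact ⟨_, ⟨a, b, rfl⟩, _, ⟨c, d, rfl⟩, (k1 a b c d).symm⟩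
  rw [e1, e2, qm_eq']
  constructor
  · rw [Submodule.span_le]
    rintro _ ⟨a, b, c, d, rfl⟩
    have hm : t2.dL b ∘L W ∘L t2.flip.insL c ∈ closure (FR H : Set (H →L[ℂ] H)) := by
      rw [← hreg']
      exact subset_closure (Submodule.subset_span ((hsl _).2 ⟨b, c, rfl⟩))
    refine map_mem_closure (hΨ a d) hm ?_
    have : FR H ≤ (Submodule.span ℂ
      {T | ∃ a b c d, T = Ψ a d (InnerProductSpace.rankOne ℂ c b)}).comap (Ψ a d) := by
      rw [FR, Submodule.span_le]
      rintro _ ⟨c, b, rfl⟩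
      exact Submodule.subset_span ⟨a, b, c, d, rfl⟩
    exact this
  · rw [Submodule.span_le]
    rintro _ ⟨a, b, c, d, rfl⟩
    have hm : InnerProductSpace.rankOne ℂ c b ∈
        closure ((Submodule.span ℂ (slicesR t2 t2 (Sg * W)) : Submodule ℂ _) :
          Set (H →L[ℂ] H)) := by
      rw [hreg']
      exact subset_closure (rankOne_mem_FR _ _)
    refine map_mem_closure (hΨ a d) hm ?_
    have : Submodule.span ℂ (slicesR t2 t2 (Sg * W)) ≤ (Submodule.span ℂ
      {T | ∃ a b c d, T = Ψ a d (t2.dL b ∘L W ∘L t2.flip.insL c)}).comap (Ψ a d) := by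
      rw [Submodule.span_le]
      intro T hT
      obtain ⟨b, c, rfl⟩ := (hsl T).1 hT
      exact Submodule.subset_span ⟨a, b, c, d, rfl⟩
    exact this

section core

variable {H H2 H3 : Type*}
    [NormedAddCommGroup H] [InnerProductSpace ℂ H] [CompleteSpace H]
    [NormedAddCommGroup H2] [InnerProductSpace ℂ H2] [CompleteSpace H2]
    [NormedAddCommGroup H3] [InnerProductSpace ℂ H3] [CompleteSpace H3]

/-- The decomposition `(12)|3`. -/
def P3 (t2 : TensorPair H H H2) (t3 : TensorTriple H H H H3) : TensorPair H2 H H3 := t3.pair t2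

/-- The decomposition `(13)|2`. -/
def P2 (t2 : TensorPair H H H2) (t3 : TensorTriple H H H H3) : TensorPair H2 H H3 :=
  t3.swap23.pair t2

/-- The decomposition `(23)|1`. -/
def P1 (t2 : TensorPair H H H2) (t3 : TensorTriple H H H H3) : TensorPair H2 H H3 :=
  t3.swap12.swap23.pair t2

variable (t2 : TensorPair H H H2) (t3 : TensorTriple H H H H3)

@[simp] lemma P3_tmul (a b c : H) : (P3 t2 t3).tmul (t2.tmul a b) c = t3.tmul a b c := by
  simp [P3]

@[simp] lemma P2_tmul (a b c : H) : (P2 t2 t3).tmul (t2.tmul a c) b = t3.tmul a b c := by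
  simp [P2]

@[simp] lemma P1_tmul (a b c : H) : (P1 t2 t3).tmul (t2.tmul b c) a = t3.tmul a b c := by
  simp [P1]

@[simp] lemma P3_opL (X : H2 →L[ℂ] H2) (a b c : H) :
    (P3 t2 t3).opL X (t3.tmul a b c) = (P3 t2 t3).tmul (X (t2.tmul a b)) c := by
  rw [← P3_tmul t2, TensorPair.opL_tmul]

@[simp] lemma P2_opL (X : H2 →L[ℂ] H2) (a b c : H) :
    (P2 t2 t3).opL X (t3.tmul a b c) = (P2 t2 t3).tmul (X (t2.tmul a c)) b := by
  rw [← P2_tmul t2, TensorPair.opL_tmul]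

@[simp] lemma P1_opL (X : H2 →L[ℂ] H2) (a b c : H) :
    (P1 t2 t3).opL X (t3.tmul a b c) = (P1 t2 t3).tmul (X (t2.tmul b c)) a := by
  rw [← P1_tmul t2, TensorPair.opL_tmul]

@[simp] lemma P3_opR (X : H →L[ℂ] H) (a b c : H) :
    (P3 t2 t3).opR X (t3.tmul a b c) = t3.tmul a b (X c) := by
  rw [← P3_tmul t2, TensorPair.opR_tmul, P3_tmul]

@[simp] lemma P2_opR (X : H →L[ℂ] H) (a b c : H) :
    (P2 t2 t3).opR X (t3.tmul a b c) = t3.tmul a (X b) c := by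
  rw [← P2_tmul t2, TensorPair.opR_tmul, P2_tmul]

@[simp] lemma P1_opR (X : H →L[ℂ] H) (a b c : H) :
    (P1 t2 t3).opR X (t3.tmul a b c) = t3.tmul (X a) b c := by
  rw [← P1_tmul t2, TensorPair.opR_tmul, P1_tmul]

lemma qmap_of_eq {V V' V'' : Type*} [NormedRing V] [NormedAlgebra ℂ V] [NormedRing V']
    [NormedAlgebra ℂ V'] [NormedRing V''] [NormedAlgebra ℂ V'']
    (φ : V →ₐ[ℂ] V') (ψ : V' →ₐ[ℂ] V'') (hψ : Continuous ψ) (χ : V →ₐ[ℂ] V'')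
    (h : ∀ x, ψ (φ x) = χ x) (X : Submodule ℂ V) :
    qmap ψ hψ (qm (X.map φ.toLinearMap)) = qm (X.map χ.toLinearMap) := by
  rw [qmap_qm, ← Submodule.map_comp]
  congr 2
  ext x
  exact h x

/-- Transport along the legs 12. -/
def q12 : QM (H2 →L[ℂ] H2) →* QM (H3 →L[ℂ] H3) := qmap (P3 t2 t3).opL (P3 t2 t3).opL_cont
/-- Transport along the legs 13. -/
def q13 : QM (H2 →L[ℂ] H2) →* QM (H3 →L[ℂ] H3) := qmap (P2 t2 t3).opL (P2 t2 t3).opL_cont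
/-- Transport along the legs 23. -/
def q23 : QM (H2 →L[ℂ] H2) →* QM (H3 →L[ℂ] H3) := qmap (P1 t2 t3).opL (P1 t2 t3).opL_cont

lemma q12_qL (X) : q12 t2 t3 (t2.qL X) = (P1 t2 t3).qR X :=
  qmap_of_eq _ _ _ _ (fun x => by apply t3.ext_op; simp) X
lemma q12_qR (X) : q12 t2 t3 (t2.qR X) = (P2 t2 t3).qR X :=
  qmap_of_eq _ _ _ _ (fun x => by apply t3.ext_op; simp) X
lemma q13_qL (X) : q13 t2 t3 (t2.qL X) = (P1 t2 t3).qR X :=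
  qmap_of_eq _ _ _ _ (fun x => by apply t3.ext_op; simp) X
lemma q13_qR (X) : q13 t2 t3 (t2.qR X) = (P3 t2 t3).qR X :=
  qmap_of_eq _ _ _ _ (fun x => by apply t3.ext_op; simp) X
lemma q23_qL (X) : q23 t2 t3 (t2.qL X) = (P2 t2 t3).qR X :=
  qmap_of_eq _ _ _ _ (fun x => by apply t3.ext_op; simp) X
lemma q23_qR (X) : q23 t2 t3 (t2.qR X) = (P3 t2 t3).qR X :=
  qmap_of_eq _ _ _ _ (fun x => by apply t3.ext_op; simp) X

lemma q12_qs (w) : q12 t2 t3 (qs w) = qs ((P3 t2 t3).opL w) := qmap_qs _ _ w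
lemma q13_qs (w) : q13 t2 t3 (qs w) = qs ((P2 t2 t3).opL w) := qmap_qs _ _ w
lemma q23_qs (w) : q23 t2 t3 (qs w) = qs ((P1 t2 t3).opL w) := qmap_qs _ _ w

/-- A regular multiplicative unitary. -/
structure RegMU (W : H2 →L[ℂ] H2) : Prop where
  u1 : star W * W = 1
  u2 : W * star W = 1
  pent : (P1 t2 t3).opL W * (P3 t2 t3).opL W =
    (P3 t2 t3).opL W * (P2 t2 t3).opL W * (P1 t2 t3).opL W
  reg : t2.qL (FR H) * qs W * t2.qR (FR H) = t2.qL (FR H) * t2.qR (FR H)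

variable {t2 t3} {W : H2 →L[ℂ] H2}

lemma qs_inv {V : Type*} [NormedRing V] [NormedAlgebra ℂ V] {u w : V} (h : u * w = 1) :
    qs u * qs w = 1 := by rw [qs_mul, h, qs_one]

lemma RegMU.core₀ [Nontrivial H] (h : RegMU t2 t3 W) :
    qm (adj (t2.SL W)) = qm (t2.SL W) ∧
    t2.qL (FR H) * qs W * t2.qR (t2.SL W) = t2.qL (FR H) * t2.qR (t2.SL W) ∧
    qs W * t2.qL (FR H) * t2.qR (t2.SL W) = t2.qL (FR H) * t2.qR (t2.SL W) := by
  have hF := t2.qL_FR_mul_qR_FR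
  have hb2 : qs W * (t2.qL (FR H) * t2.qR (FR H)) = t2.qL (FR H) * t2.qR (FR H) := by
    rw [hF, qs_mul_FR h.u2]
  have hc2 : qs (star W) * (t2.qL (FR H) * t2.qR (FR H)) = t2.qL (FR H) * t2.qR (FR H) := by
    rw [hF, qs_mul_FR h.u1]
  have hc1 : (t2.qL (FR H) * t2.qR (FR H)) * qs (star W) = t2.qL (FR H) * t2.qR (FR H) := by
    rw [hF, FR_mul_qs h.u2]
  have hr' : t2.qR (FR H) * qs (star W) * t2.qL (FR H) = t2.qL (FR H) * t2.qR (FR H) := by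
    have := congrArg qstar h.reg
    simp only [qstar_mul, TensorPair.qstar_qL, TensorPair.qstar_qR, qstar_qs, adj_FR] at this
    rw [mul_assoc, this, ← TensorPair.qL_qR]
  have kk : ∀ p : TensorPair H2 H H3, p.qR (FR H) * p.qR (FR H) = p.qR (FR H) := fun p => by
    rw [← TensorPair.qR_mul, FR_mul_FR]
  have hW := words_core (k1 := (P1 t2 t3).qR (FR H)) (k2 := (P2 t2 t3).qR (FR H))
    (a3 := (P3 t2 t3).qR (t2.SL W)) (s3 := (P3 t2 t3).qR (adj (t2.SL W)))
    (w12 := qs ((P3 t2 t3).opL W)) (w13 := qs ((P2 t2 t3).opL W)) (w23 := qs ((P1 t2 t3).opL W))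
    (u12 := qs ((P3 t2 t3).opL (star W))) (u13 := qs ((P2 t2 t3).opL (star W)))
    (qs_inv (by rw [← map_mul, h.u1, map_one])) (qs_inv (by rw [← map_mul, h.u2, map_one]))
    (qs_inv (by rw [← map_mul, h.u1, map_one]))
    (by rw [qs_mul, qs_mul, qs_mul, h.pent])
    (by simpa only [map_mul, q12_qL, q12_qR] using
      congrArg (q12 t2 t3) (t2.qL_qR (FR H) (FR H)))
    (kk _) (kk _)
    (by simpa only [map_mul, q23_qL, q23_qR] using
      congrArg (q23 t2 t3) (t2.qL_qR (FR H) (adj (t2.SL W))))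
    (TensorPair.qs_opL_qR _ _ _) (TensorPair.qs_opL_qR _ _ _) (TensorPair.qs_opL_qR _ _ _)
    (by simpa only [map_mul, q12_qL, q12_qR, q12_qs] using congrArg (q12 t2 t3) hb2)
    (by simpa only [map_mul, q12_qL, q12_qR, q12_qs] using congrArg (q12 t2 t3) hc1)
    (by simpa only [map_mul, q12_qL, q12_qR, q12_qs] using congrArg (q12 t2 t3) hc2)
    (by simpa only [map_mul, q12_qL, q12_qR, q12_qs] using congrArg (q12 t2 t3) h.reg)
    (by simpa only [map_mul, q12_qL, q12_qR, q12_qs] using congrArg (q12 t2 t3) hr')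
    (by simpa only [map_mul, q23_qL, q23_qR, q23_qs] using
      congrArg (q23 t2 t3) (t2.qL_qs_qL W))
    (by simpa only [map_mul, q13_qL, q13_qR, q13_qs, TensorPair.SL_star] using
      congrArg (q13 t2 t3) (t2.qL_qs_qL (star W)))
  obtain ⟨h1, h2, h3⟩ := hW
  have hnt : Nontrivial H2 := by
    obtain ⟨x, hx⟩ := exists_ne (0 : H)
    refine ⟨t2.tmul x x, 0, ?_⟩
    rw [← norm_ne_zero_iff, t2.norm_tmul]
    simpa using hx
  refine ⟨?_, ?_, ?_⟩
  · have hk : (P1 t2 t3).qR (FR H) * (P2 t2 t3).qR (FR H) = (P3 t2 t3).qL (FR H2) := by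
      have := congrArg (q12 t2 t3) hF
      rw [map_mul, q12_qL, q12_qR] at this
      exact this
    rw [hk, ← TensorPair.qR_mul, TensorPair.qL_qR, TensorPair.qL_qR] at h1
    have h4 : qm (adj (t2.SL W) * t2.SL W) = qm (t2.SL W) := (P3 t2 t3).flip.descent h1
    have h5 := congrArg qstar h4
    rw [qstar_qm, qstar_qm, adj_mul, adj_adj, h4] at h5
    exact h5.symm
  · apply (P2 t2 t3).descent'
    change _ * q13 t2 t3 _ = _ * q13 t2 t3 _
    rw [map_mul, map_mul, map_mul, q13_qL, q13_qR, q13_qs]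
    exact h2
  · apply (P2 t2 t3).descent'
    change _ * q13 t2 t3 _ = _ * q13 t2 t3 _
    rw [map_mul, map_mul, map_mul, q13_qL, q13_qR, q13_qs]
    exact h3

lemma RegMU.core [Nontrivial H] (h : RegMU t2 t3 W) :
    qm (adj (t2.SL W)) = qm (t2.SL W) ∧
    t2.qL (FR H) * qs W * t2.qR (t2.SL W) = t2.qL (FR H) * t2.qR (t2.SL W) ∧
    qs W * (t2.qL (FR H) * t2.qR (t2.SL W)) = t2.qL (FR H) * t2.qR (t2.SL W) ∧
    qs (star W) * (t2.qL (FR H) * t2.qR (t2.SL W)) = t2.qL (FR H) * t2.qR (t2.SL W) ∧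
    t2.qL (FR H) * t2.qR (t2.SL W) * qs W = t2.qL (FR H) * t2.qR (t2.SL W) ∧
    t2.qL (FR H) * t2.qR (t2.SL W) * qs (star W) = t2.qL (FR H) * t2.qR (t2.SL W) := by
  obtain ⟨h1, h2, h3⟩ := h.core₀
  rw [mul_assoc] at h3
  have h4 : qs (star W) * (t2.qL (FR H) * t2.qR (t2.SL W)) = t2.qL (FR H) * t2.qR (t2.SL W) := by
    nth_rw 1 [← h3]
    rw [← mul_assoc, qs_inv h.u1, one_mul]
  have hs : qstar (t2.qL (FR H) * t2.qR (t2.SL W)) = t2.qL (FR H) * t2.qR (t2.SL W) := by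
    rw [qstar_mul, TensorPair.qstar_qL, TensorPair.qstar_qR, adj_FR, t2.qR_congr h1,
      TensorPair.qL_qR]
  refine ⟨h1, h2, h3, h4, ?_, ?_⟩
  · have := congrArg qstar h4
    rwa [qstar_mul, hs, qstar_qs, star_star] at this
  · have := congrArg qstar h3
    rwa [qstar_mul, hs, qstar_qs] at this

lemma pair_ext (t2 : TensorPair H H H2) {p q : TensorPair H2 H H3}
    (h : ∀ a b c, p.tmul (t2.tmul a b) c = q.tmul (t2.tmul a b) c) : p = q := by
  have h1 : p.tmul = q.tmul := by
    ext z c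
    have : p.flip.insL c = q.flip.insL c := by
      apply t2.ext_op; intro a b; exact h a b c
    exact congrArg (fun f => f z) this
  cases p; cases q; cases h1; rfl

/-- The dual multiplicative unitary. -/
lemma RegMU.dual (h : RegMU t2 t3 W) :
    RegMU t2.flip t3.swap12.swap23.swap12 (star W) := by
  have e3 : P3 t2.flip t3.swap12.swap23.swap12 = P1 t2 t3 := by
    apply pair_ext t2
    intro b c a
    rw [P1_tmul]
    exact P3_tmul t2.flip t3.swap12.swap23.swap12 c b a
  have e2 : P2 t2.flip t3.swap12.swap23.swap12 = P2 t2 t3 := by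
    apply pair_ext t2
    intro a c b
    rw [P2_tmul]
    exact P2_tmul t2.flip t3.swap12.swap23.swap12 c b a
  have e1 : P1 t2.flip t3.swap12.swap23.swap12 = P3 t2 t3 := by
    apply pair_ext t2
    intro a b c
    rw [P3_tmul]
    exact P1_tmul t2.flip t3.swap12.swap23.swap12 c b a
  refine ⟨by rw [star_star, h.u2], by rw [star_star, h.u1], ?_, ?_⟩
  · rw [e1, e2, e3]
    have := congrArg star h.pent
    rw [star_mul, star_mul, star_mul, TensorPair.opL_star, TensorPair.opL_star,
      TensorPair.opL_star] at this
    rw [this, mul_assoc]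
  · have := congrArg qstar h.reg
    simp only [qstar_mul, TensorPair.qstar_qL, TensorPair.qstar_qR, qstar_qs, adj_FR] at this
    rw [TensorPair.flip_qL, TensorPair.flip_qR, mul_assoc, this]

lemma RegMU.final [Nontrivial H] (h : RegMU t2 t3 W) :
    t2.qL (t2.flip.SL (star W)) * qs W * t2.qR (t2.SL W)
      = t2.qL (t2.flip.SL (star W)) * t2.qR (t2.SL W) ∧
    qs W * (t2.qL (t2.flip.SL (star W)) * t2.qR (t2.SL W))
      = t2.qL (t2.flip.SL (star W)) * t2.qR (t2.SL W) ∧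
    t2.qL (t2.flip.SL (star W)) * t2.qR (t2.SL W) * qs W
      = t2.qL (t2.flip.SL (star W)) * t2.qR (t2.SL W) := by
  obtain ⟨a1, a2, a3, a4, a5, a6⟩ := h.core
  obtain ⟨b1, b2, b3, b4, b5, b6⟩ := h.dual.core
  simp only [TensorPair.flip_qL, TensorPair.flip_qR, star_star] at b1 b2 b3 b4 b5 b6
  have hA := t2.flip.qL_qs_qL W
  have hS : t2.flip.SL W = adj (t2.flip.SL (star W)) := by rw [TensorPair.SL_star, adj_adj]
  rw [TensorPair.flip_qL, TensorPair.flip_qR, hS, t2.qL_congr b1] at hA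
  obtain ⟨h1, h2, h3⟩ := words_final (k2 := (P2 t2 t3).qR (FR H))
    (h1 := (P1 t2 t3).qR (t2.flip.SL (star W))) (a3 := (P3 t2 t3).qR (t2.SL W))
    (w12 := qs ((P3 t2 t3).opL W)) (w13 := qs ((P2 t2 t3).opL W)) (w23 := qs ((P1 t2 t3).opL W))
    (u12 := qs ((P3 t2 t3).opL (star W))) (u23 := qs ((P1 t2 t3).opL (star W)))
    (qs_inv (by rw [← map_mul, h.u1, map_one])) (qs_inv (by rw [← map_mul, h.u2, map_one]))
    (by rw [qs_mul, qs_mul, qs_mul, h.pent])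
    (by simpa only [map_mul, q12_qL, q12_qR] using
      congrArg (q12 t2 t3) (t2.qL_qR (t2.flip.SL (star W)) (FR H)).symm)
    (by simpa only [map_mul, q23_qL, q23_qR] using
      congrArg (q23 t2 t3) (t2.qL_qR (FR H) (t2.SL W)))
    (TensorPair.qs_opL_qR _ _ _) (TensorPair.qs_opL_qR _ _ _) (TensorPair.qs_opL_qR _ _ _)
    (TensorPair.qs_opL_qR _ _ _) (TensorPair.qs_opL_qR _ _ _)
    (by simpa only [map_mul, q12_qL, q12_qR, q12_qs] using congrArg (q12 t2 t3) hA)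
    (by simpa only [map_mul, q23_qL, q23_qR, q23_qs] using congrArg (q23 t2 t3) a2)
    (by simpa only [map_mul, q23_qL, q23_qR, q23_qs] using congrArg (q23 t2 t3) a3)
    (by simpa only [map_mul, q23_qL, q23_qR, q23_qs] using congrArg (q23 t2 t3) a4)
    (by simpa only [map_mul, q23_qL, q23_qR, q23_qs] using congrArg (q23 t2 t3) a5)
    (by simpa only [map_mul, q23_qL, q23_qR, q23_qs] using congrArg (q23 t2 t3) a6)
    (by simpa only [map_mul, q12_qL, q12_qR, q12_qs] using congrArg (q12 t2 t3) b4)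
    (by simpa only [map_mul, q12_qL, q12_qR, q12_qs] using congrArg (q12 t2 t3) b3)
    (by simpa only [map_mul, q12_qL, q12_qR, q12_qs] using congrArg (q12 t2 t3) b6)
    (by simpa only [map_mul, q12_qL, q12_qR, q12_qs] using congrArg (q12 t2 t3) b5)
  refine ⟨?_, ?_, ?_⟩
  · apply (P2 t2 t3).descent'
    change _ * q13 t2 t3 _ = _ * q13 t2 t3 _
    rw [map_mul, map_mul, map_mul, q13_qL, q13_qR, q13_qs]
    exact h1
  · apply (P2 t2 t3).descent'
    change _ * q13 t2 t3 _ = _ * q13 t2 t3 _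
    rw [map_mul, map_mul, q13_qL, q13_qR, q13_qs]
    exact h2
  · apply (P2 t2 t3).descent'
    change _ * q13 t2 t3 _ = _ * q13 t2 t3 _
    rw [map_mul, map_mul, q13_qL, q13_qR, q13_qs]
    exact h3

end core

lemma cspan_eq_tc {V : Type*} [NormedAddCommGroup V] [NormedSpace ℂ V] (S : Set V) :
    cspan S = ((Submodule.span ℂ S).topologicalClosure : Set V) := rfl

lemma qm_tc {V : Type*} [NormedRing V] [NormedAlgebra ℂ V] (X : Submodule ℂ V) :
    qm X.topologicalClosure = qm X := by
  rw [qm_eq']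
  exact ⟨le_refl _, X.le_topologicalClosure.trans (Submodule.le_topologicalClosure _)⟩

lemma mult_of_qm {V : Type*} [NormedRing V] [NormedAlgebra ℂ V] {N : Submodule ℂ V} {W : V}
    (h1 : qs W * qm N = qm N) (h2 : qm N * qs W = qm N) {x : V}
    (hx : x ∈ N.topologicalClosure) :
    W * x ∈ N.topologicalClosure ∧ x * W ∈ N.topologicalClosure := by
  rw [qs, ← map_mul, qm_eq] at h1 h2
  have hx' : x ∈ closure (N : Set V) := hx
  constructor
  · rw [← h1]
    exact map_mem_closure (f := fun x => W * x) (by fun_prop) hx' (fun a ha =>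
      Submodule.mul_mem_mul (Submodule.mem_span_singleton_self W) ha)
  · rw [← h2]
    exact map_mem_closure (f := fun x => x * W) (by fun_prop) hx' (fun a ha =>
      Submodule.mul_mem_mul ha (Submodule.mem_span_singleton_self W))

lemma main_nontrivial
    {H H2 H3 : Type*}
    [NormedAddCommGroup H] [InnerProductSpace ℂ H] [CompleteSpace H]
    [NormedAddCommGroup H2] [InnerProductSpace ℂ H2] [CompleteSpace H2]
    [NormedAddCommGroup H3] [InnerProductSpace ℂ H3] [CompleteSpace H3]
    [Nontrivial H]
    (t2 : TensorPair H H H2) (t3 : TensorTriple H H H H3)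
    (W : H2 →L[ℂ] H2) (hW : RegMU t2 t3 W)
    (Sg : H2 →L[ℂ] H2) (hSg : ∀ a b : H, Sg (t2.tmul a b) = t2.tmul b a)
    (D : Set (H2 →L[ℂ] H2))
    (hD : D = minTensor t2 (legA t2 (Sg * star W * Sg)) (legA t2 W)) :
    (∀ x ∈ D, W * x ∈ D ∧ x * W ∈ D) ∧
    cspan {y : H2 →L[ℂ] H2 | ∃ a ∈ legA t2 (Sg * star W * Sg), ∃ b ∈ legA t2 W,
        ∃ Ta Tb : H2 →L[ℂ] H2, IsTensorOp t2 t2 a 1 Ta ∧ IsTensorOp t2 t2 1 b Tb ∧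
          y = Ta * W * Tb} = D := by
  have hSs : ∀ x y, ⟪x, Sg y⟫_ℂ = ⟪Sg x, y⟫_ℂ := by
    have : adjoint Sg = Sg := by
      apply t2.ext_op; intro a b; apply t2.ext_vec; intro c d
      rw [ContinuousLinearMap.adjoint_inner_right, hSg, hSg, t2.inner_tmul, t2.inner_tmul, mul_comm]
    intro x y
    nth_rw 1 [← this]
    rw [ContinuousLinearMap.adjoint_inner_right]
  have hsl : slicesL t2 t2 (Sg * star W * Sg) = slicesL t2.flip t2.flip (star W) := by
    have : ∀ ξ ζ η ζ' : H, ⟪t2.tmul ξ ζ, (Sg * star W * Sg) (t2.tmul η ζ')⟫_ℂ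
        = ⟪t2.flip.tmul ξ ζ, star W (t2.flip.tmul η ζ')⟫_ℂ := by
      intro ξ ζ η ζ'
      change ⟪t2.tmul ξ ζ, Sg (star W (Sg (t2.tmul η ζ')))⟫_ℂ = _
      rw [hSs, hSg, hSg]; rfl
    ext T
    simp only [slicesL, Set.mem_ofPred_eq, this]
  obtain ⟨f1, f2, f3⟩ := hW.final
  set S' := t2.flip.SL (star W) with hS'
  set S := t2.SL W with hS
  have hA' : ∀ a, a ∈ legA t2 (Sg * star W * Sg) ↔ a ∈ S'.topologicalClosure := by
    intro a; rw [legA, hsl]; rfl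
  have hA : ∀ a, a ∈ legA t2 W ↔ a ∈ S.topologicalClosure := fun a => Iff.rfl
  have hqL : t2.qL S'.topologicalClosure = t2.qL S' := t2.qL_congr (qm_tc _)
  have hqR : t2.qR S.topologicalClosure = t2.qR S := t2.qR_congr (qm_tc _)
  have hD1 : D = ((S'.topologicalClosure.map t2.opL.toLinearMap *
      S.topologicalClosure.map t2.opR.toLinearMap).topologicalClosure : Set _) := by
    rw [hD, minTensor, cspan_eq_tc, Submodule.mul_eq_span_mul_set]
    congr 3
    ext T
    constructor
    · rintro ⟨a, ha, b, hb, h⟩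
      rw [t2.isTensorOp_iff] at h
      exact ⟨_, ⟨a, (hA' a).1 ha, rfl⟩, _, ⟨b, (hA b).1 hb, rfl⟩, h.symm⟩
    · rintro ⟨_, ⟨a, ha, rfl⟩, _, ⟨b, hb, rfl⟩, rfl⟩
      exact ⟨a, (hA' a).2 ha, b, (hA b).2 hb, (t2.isTensorOp_iff _ _ _).2 rfl⟩
  have hN : qm (S'.topologicalClosure.map t2.opL.toLinearMap *
      S.topologicalClosure.map t2.opR.toLinearMap) = t2.qL S' * t2.qR S := by
    rw [map_mul, ← hqL, ← hqR]; rfl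
  constructor
  · intro x hx
    rw [hD1] at hx ⊢
    exact mult_of_qm (by rw [hN, f2]) (by rw [hN, f3]) hx
  · have hM : qm (S'.topologicalClosure.map t2.opL.toLinearMap * Submodule.span ℂ {W} *
      S.topologicalClosure.map t2.opR.toLinearMap) = t2.qL S' * t2.qR S := by
      rw [map_mul, map_mul, ← f1, ← hqL, ← hqR]; rfl
    rw [← hN, qm_eq] at hM
    rw [hD1, ← hM, cspan_eq_tc]
    rw [← Submodule.span_eq (S'.topologicalClosure.map t2.opL.toLinearMap),
      ← Submodule.span_eq (S.topologicalClosure.map t2.opR.toLinearMap),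
      Submodule.span_mul_span, Submodule.span_mul_span]
    congr 3
    ext T
    constructor
    · rintro ⟨a, ha, b, hb, Ta, Tb, hTa, hTb, rfl⟩
      rw [t2.isTensorOp_iff, map_one, mul_one] at hTa
      rw [t2.isTensorOp_iff, map_one, one_mul] at hTb
      subst hTa hTb
      exact ⟨_, ⟨_, ⟨a, (hA' a).1 ha, rfl⟩, W, rfl, rfl⟩, _, ⟨b, (hA b).1 hb, rfl⟩, rfl⟩
    · rintro ⟨_, ⟨_, ⟨a, ha, rfl⟩, W', hW', rfl⟩, _, ⟨b, hb, rfl⟩, rfl⟩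
      rw [Set.mem_singleton_iff] at hW'
      rw [hW']
      refine ⟨a, (hA' a).2 ha, b, (hA b).2 hb, t2.opL a, t2.opR b, ?_, ?_, rfl⟩
      · rw [t2.isTensorOp_iff, map_one, mul_one]
      · rw [t2.isTensorOp_iff, map_one, one_mul]

/-- For a bi-regular multiplicative unitary `W` on `H`, with
`Ŵ := ΣW*Σ` and `D := A(Ŵ) ⊗min A(W)`, the unitary `W` is a multiplier of `D`
and `[(a ⊗ 1)·W·(1 ⊗ b) : a ∈ A(Ŵ), b ∈ A(W)] = A(Ŵ) ⊗min A(W)`. -/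
theorem statement18
    {H H2 H3 : Type*}
    [NormedAddCommGroup H] [InnerProductSpace ℂ H] [CompleteSpace H]
    [NormedAddCommGroup H2] [InnerProductSpace ℂ H2] [CompleteSpace H2]
    [NormedAddCommGroup H3] [InnerProductSpace ℂ H3] [CompleteSpace H3]
    -- realizations of the tensor products H ⊗ H and H ⊗ H ⊗ H
    (t2 : TensorPair H H H2) (t3 : TensorTriple H H H H3)
    -- W is a unitary on H ⊗ H
    (W : H2 →L[ℂ] H2) (hWu : star W * W = 1 ∧ W * star W = 1)
    -- the legs W₁₂, W₂₃, W₁₃ of W on H ⊗ H ⊗ H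
    (W12 W23 W13 : H3 →L[ℂ] H3)
    (hW12 : IsLeg12 t2 t3 W W12) (hW23 : IsLeg23 t2 t3 W W23)
    (hW13 : IsLeg13 t2 t3 W W13)
    -- the pentagon equation W₂₃W₁₂ = W₁₂W₁₃W₂₃
    (hpent : W23 * W12 = W12 * W13 * W23)
    -- the tensor flip Σ on H ⊗ H
    (Sg : H2 →L[ℂ] H2) (hSg : ∀ a b : H, Sg (t2.tmul a b) = t2.tmul b a)
    -- bi-regularity: C(W) = K(H) and [(ω_{ξ,η} ⊗ id)(ΣW)] = K(H)
    (hreg : hatA t2 (Sg * W) = {T : H →L[ℂ] H | IsCompactOperator T})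
    (hreg' : legA t2 (Sg * W) = {T : H →L[ℂ] H | IsCompactOperator T})
    (D : Set (H2 →L[ℂ] H2))
    (hD : D = minTensor t2 (legA t2 (Sg * star W * Sg)) (legA t2 W)) :
    (∀ x ∈ D, W * x ∈ D ∧ x * W ∈ D) ∧
    cspan {y : H2 →L[ℂ] H2 | ∃ a ∈ legA t2 (Sg * star W * Sg), ∃ b ∈ legA t2 W,
        ∃ Ta Tb : H2 →L[ℂ] H2, IsTensorOp t2 t2 a 1 Ta ∧ IsTensorOp t2 t2 1 b Tb ∧
          y = Ta * W * Tb} = D := by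
  rcases subsingleton_or_nontrivial H with hs | hnt
  · have hss : Subsingleton (H2 →L[ℂ] H2) := by
      constructor
      intro f g
      apply t2.ext_op
      intro a b
      rw [Subsingleton.elim a 0]; simp
    have h0 : ∀ S : Set (H2 →L[ℂ] H2), cspan S = Set.univ := by
      intro S
      ext y
      simp only [Set.mem_univ, iff_true]
      rw [Subsingleton.elim y 0]
      exact subset_closure (Submodule.zero_mem _)
    have hDu : D = Set.univ := by rw [hD, minTensor, h0]
    rw [hDu, h0]
    exact ⟨fun x _ => ⟨Set.mem_univ _, Set.mem_univ _⟩, rfl⟩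
  · have e12 : W12 = (P3 t2 t3).opL W := by
      apply t3.ext_op; intro a b c; apply t3.ext_vec; intro a' b' c'
      rw [hW12, P3_opL, ← P3_tmul t2, (P3 t2 t3).inner_tmul]
    have e13 : W13 = (P2 t2 t3).opL W := by
      apply t3.ext_op; intro a b c; apply t3.ext_vec; intro a' b' c'
      rw [hW13, P2_opL, ← P2_tmul t2, (P2 t2 t3).inner_tmul]
    have e23 : W23 = (P1 t2 t3).opL W := by
      apply t3.ext_op; intro a b c; apply t3.ext_vec; intro a' b' c'
      rw [hW23, P1_opL, ← P1_tmul t2, (P1 t2 t3).inner_tmul]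
    have hR : RegMU t2 t3 W :=
      ⟨hWu.1, hWu.2, by rw [← e12, ← e13, ← e23, hpent], reg_qm t2 W Sg hSg hreg⟩
    exact main_nontrivial t2 t3 W hR Sg hSg D hD

end
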